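/- arXiv:1909.09379 — 3 statements merged into one kernel-verified Lean document; each statement's English description precedes it below -/
import Mathlib

section
/- Let Ω ⊂ ℝ^N be a bounded Lipschitz domain, s ∈ (0,1), and p: Ω̄×Ω̄ → ℝ uniformly continuous and symmetric (p(x,y)=p(y,x)) with 1 < inf p ≤ sup p < N/s, satisfying the log-Hölder type continuity condition: inf_{ε>0} sup{ |p(x,y) − inf_{Ω_{x,ε}×Ω_{y,ε}} p| · log(1/|x−y|) : (x,y) ∈ Ω×Ω, 0 < |x−y| < 1/2 } < ∞, where Ω_{z,ε} := B_ε(z) ∩ Ω. Let q: Ω̄ → ℝ be continuous with 1 < inf q ≤ sup q < ∞ such that for every x ∈ Ω there exists ε > 0 with sup_{y∈Ω_{x,ε}} q(y) ≤ N·p_ε/(N − s·p_ε), where p_ε := inf_{(y,z)∈Ω_{x,ε}×Ω_{x,ε}} p(y,z). Then W^{s,p(·,·)}(Ω) embeds continuously into L^{q(·)}(Ω): there exists C > 0 such that ‖u‖_{L^{q(·)}(Ω)} ≤ C‖u‖_{s,p} for all u ∈ W^{s,p(·,·)}(Ω). -/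
open MeasureTheory Filter Topology Set
open scoped ENNReal NNReal

noncomputable section

/-- Euclidean space `ℝ^N`. -/
abbrev Euc (N : ℕ) := EuclideanSpace ℝ (Fin N)

/-- The modular of the variable exponent Lebesgue space `L^{h(·)}_μ`. -/
def varModular {α : Type*} [MeasurableSpace α] (μ : Measure α) (h : α → ℝ) (u : α → ℝ) : ℝ≥0∞ :=
  ∫⁻ x, ENNReal.ofReal (|u x| ^ (h x)) ∂μ

/-- The Luxemburg norm on the variable exponent Lebesgue space `L^{h(·)}_μ`. -/
def luxNorm {α : Type*} [MeasurableSpace α] (μ : Measure α) (h : α → ℝ) (u : α → ℝ) : ℝ :=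
  sInf {c : ℝ | 0 < c ∧ varModular μ h (fun x => u x / c) ≤ 1}

/-- Membership in the variable exponent Lebesgue space `L^{h(·)}_μ`. -/
def MemVarLp {α : Type*} [MeasurableSpace α] (μ : Measure α) (h : α → ℝ) (u : α → ℝ) : Prop :=
  AEStronglyMeasurable u μ ∧ varModular μ h u < ⊤

/-- The integrand of the Gagliardo-type seminorm with variable exponent. -/
def sobKernel {N : ℕ} (s : ℝ) (p : Euc N → Euc N → ℝ) (u : Euc N → ℝ) (x y : Euc N) : ℝ≥0∞ :=
  ENNReal.ofReal (|u x - u y| ^ (p x y) / dist x y ^ ((N : ℝ) + s * p x y))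

/-- The modular of the fractional Sobolev space `W^{s,p(·,·)}(Ω)`. -/
def sobModular {N : ℕ} (Ω : Set (Euc N)) (s : ℝ) (p : Euc N → Euc N → ℝ)
    (u : Euc N → ℝ) : ℝ≥0∞ :=
  (∫⁻ x in Ω, ENNReal.ofReal (|u x| ^ (p x x))) + ∫⁻ x in Ω, ∫⁻ y in Ω, sobKernel s p u x y

/-- The Luxemburg-type norm of the fractional Sobolev space `W^{s,p(·,·)}(Ω)`. -/
def sobNorm {N : ℕ} (Ω : Set (Euc N)) (s : ℝ) (p : Euc N → Euc N → ℝ) (u : Euc N → ℝ) : ℝ :=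
  sInf {c : ℝ | 0 < c ∧ sobModular Ω s p (fun x => u x / c) ≤ 1}

/-- Membership in the fractional Sobolev space `W^{s,p(·,·)}(Ω)`. -/
def MemSob {N : ℕ} (Ω : Set (Euc N)) (s : ℝ) (p : Euc N → Euc N → ℝ) (u : Euc N → ℝ) : Prop :=
  AEStronglyMeasurable u (volume.restrict Ω) ∧ sobModular Ω s p u < ⊤

/-- `inf` of the exponent `p` over `(B_ε(x) ∩ Ω) × (B_ε(y) ∩ Ω)`. -/
def locInf {N : ℕ} (Ω : Set (Euc N)) (p : Euc N → Euc N → ℝ) (ε : ℝ) (x y : Euc N) : ℝ :=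
  sInf (Set.image2 p (Metric.ball x ε ∩ Ω) (Metric.ball y ε ∩ Ω))

/-- Log-Hölder type continuity condition on the exponent `p`:
`inf_{ε>0} sup { |p(x,y) - inf_{Ω_{x,ε}×Ω_{y,ε}} p| · log(1/|x-y|) } < ∞`. -/
def LogHolderType {N : ℕ} (Ω : Set (Euc N)) (p : Euc N → Euc N → ℝ) : Prop :=
  ∃ ε > (0 : ℝ), ∃ C : ℝ, ∀ x ∈ Ω, ∀ y ∈ Ω, 0 < dist x y → dist x y < 1 / 2 →
    |p x y - locInf Ω p ε x y| * Real.log (1 / dist x y) ≤ C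

/-- A bounded Lipschitz domain: a nonempty bounded open set whose boundary is locally the
graph of a Lipschitz function (the domain lying locally on one side of the graph). -/
def IsBoundedLipschitzDomain {N : ℕ} (Ω : Set (Euc N)) : Prop :=
  IsOpen Ω ∧ Bornology.IsBounded Ω ∧ Ω.Nonempty ∧
    ∀ z ∈ frontier Ω, ∃ U : Set (Euc N), z ∈ U ∧ IsOpen U ∧
      ∃ (v : Euc N) (φ : Euc N → ℝ) (K : ℝ≥0), ‖v‖ = 1 ∧ LipschitzWith K φ ∧
        (∀ (x : Euc N) (t : ℝ), φ (x + t • v) = φ x) ∧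
        Ω ∩ U = {x : Euc N | φ x < @inner ℝ _ _ x v} ∩ U

lemma aux_density {N : ℕ} (Ω : Set (Euc N)) (hΩ : IsBoundedLipschitzDomain Ω) :
    ∃ r0 > (0:ℝ), ∃ κ > (0:ℝ), ∀ x ∈ Ω, ∀ r : ℝ, 0 < r → r < r0 →
      ∃ y, Metric.ball y (κ * r) ⊆ Metric.ball x r ∩ Ω := by
  obtain ⟨hop, hbd, hne, hfr⟩ := hΩ
  have hcomp : IsCompact (closure Ω) := hbd.isCompact_closure
  have key : ∃ r0 > (0:ℝ), ∃ κ > (0:ℝ), ∀ x ∈ Ω, x ∈ closure Ω → ∀ r : ℝ, 0 < r → r < r0 →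
      ∃ y, Metric.ball y (κ * r) ⊆ Metric.ball x r ∩ Ω := by
    refine hcomp.induction_on (p := fun S => ∃ r0 > (0:ℝ), ∃ κ > (0:ℝ), ∀ x ∈ Ω, x ∈ S →
      ∀ r : ℝ, 0 < r → r < r0 → ∃ y, Metric.ball y (κ * r) ⊆ Metric.ball x r ∩ Ω) ?_ ?_ ?_ ?_
    · exact ⟨1, one_pos, 1, one_pos, fun x _ h => absurd h (Set.notMem_empty x)⟩
    · rintro S T hST ⟨r0, h0, κ, hκ, H⟩
      exact ⟨r0, h0, κ, hκ, fun x hx hxS => H x hx (hST hxS)⟩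
    · rintro S T ⟨r0, h0, κ, hκ, H⟩ ⟨r1, h1, κ', hκ', H'⟩
      refine ⟨min r0 r1, lt_min h0 h1, min κ κ', lt_min hκ hκ', ?_⟩
      rintro x hx (hxS | hxT) r hr hr2
      · obtain ⟨y, hy⟩ := H x hx hxS r hr (hr2.trans_le (min_le_left _ _))
        refine ⟨y, (Metric.ball_subset_ball ?_).trans hy⟩
        exact mul_le_mul_of_nonneg_right (min_le_left _ _) hr.le
      · obtain ⟨y, hy⟩ := H' x hx hxT r hr (hr2.trans_le (min_le_right _ _))
        refine ⟨y, (Metric.ball_subset_ball ?_).trans hy⟩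
        exact mul_le_mul_of_nonneg_right (min_le_right _ _) hr.le
    · intro z hz
      by_cases hzΩ : z ∈ Ω
      · obtain ⟨δ, hδ, hb⟩ := Metric.isOpen_iff.1 hop z hzΩ
        refine ⟨Metric.ball z (δ/2), mem_nhdsWithin_of_mem_nhds (Metric.ball_mem_nhds z (by positivity)),
          δ/2, by positivity, 1, one_pos, ?_⟩
        intro x hx hxz r hr hr2
        refine ⟨x, fun y hy => ⟨by simpa using hy, hb ?_⟩⟩
        rw [Metric.mem_ball] at *
        linarith [dist_triangle y x z]
      · have hzf : z ∈ frontier Ω := by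
          rw [hop.frontier_eq]; exact ⟨hz, hzΩ⟩
        obtain ⟨U, hzU, hU, v, φ, K, hv, hφ, hinv, hEq⟩ := hfr z hzf
        obtain ⟨δ, hδ, hb⟩ := Metric.isOpen_iff.1 hU z hzU
        refine ⟨Metric.ball z (δ/2), mem_nhdsWithin_of_mem_nhds (Metric.ball_mem_nhds z (by positivity)),
          δ/2, by positivity, 1/(2*(K+1)), by positivity, ?_⟩
        intro x hx hxz r hr hr2
        have hK : (0:ℝ) ≤ K := K.2
        set ρ := 1/(2*((K:ℝ)+1)) * r with hρ
        have hρ1 : (K+1) * ρ = r/2 := by rw [hρ]; field_simp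
        have hρ0 : 0 < ρ := by positivity
        have hρ2 : ρ ≤ r/2 := by nlinarith
        refine ⟨x + (r/2) • v, fun y hy => ?_⟩
        obtain ⟨w, rfl⟩ : ∃ w, y = (x + w) + (r/2) • v := ⟨y - x - (r/2) • v, by abel⟩
        have hw : ‖w‖ < ρ := by
          rw [Metric.mem_ball, dist_eq_norm] at hy
          have e : x + w + (r/2) • v - (x + (r/2) • v) = w := by abel
          rwa [e] at hy
        have hyx : dist ((x + w) + (r/2) • v) x < r := by
          rw [dist_eq_norm]
          have : x + w + (r/2) • v - x = w + (r/2) • v := by abel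
          rw [this]
          have h1 := norm_add_le w ((r/2) • v)
          rw [norm_smul, hv, Real.norm_eq_abs, abs_of_pos (by positivity : 0 < r/2)] at h1
          linarith
        have hxU : x ∈ U := hb (Metric.ball_subset_ball (by linarith) hxz)
        have hyU : (x + w) + (r/2) • v ∈ U := by
          apply hb
          rw [Metric.mem_ball] at *
          linarith [dist_triangle ((x + w) + (r/2) • v) x z]
        have hx' : φ x < @inner ℝ _ _ x v := by
          have : x ∈ Ω ∩ U := ⟨hx, hxU⟩
          rw [hEq] at this; exact this.1
        refine ⟨hyx, ?_⟩
        have : (x + w) + (r/2) • v ∈ Ω ∩ U := by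
          rw [hEq]
          refine ⟨?_, hyU⟩
          show φ ((x + w) + (r/2) • v) < @inner ℝ _ _ ((x + w) + (r/2) • v) v
          rw [hinv, inner_add_left, inner_add_left, inner_smul_left, real_inner_self_eq_norm_sq, hv]
          have h1 : φ (x + w) - φ x ≤ K * ‖w‖ := by
            have := hφ.dist_le_mul (x + w) x
            rw [Real.dist_eq, dist_eq_norm, add_sub_cancel_left] at this
            exact (le_abs_self _).trans this
          have h2 : |@inner ℝ _ _ w v| ≤ ‖w‖ := by
            have := abs_real_inner_le_norm w v
            rwa [hv, mul_one] at this
          have h3 := neg_abs_le (@inner ℝ _ _ w v)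
          have h4 : (K:ℝ) * ‖w‖ ≤ K * ρ := by gcongr
          simp
          nlinarith
        exact this.1
  obtain ⟨r0, h0, κ, hκ, H⟩ := key
  exact ⟨r0, h0, κ, hκ, fun x hx => H x hx (subset_closure hx)⟩

lemma aux_exponent {N : ℕ} (hN : 0 < N) (Ω : Set (Euc N)) (hop : IsOpen Ω)
    (p : Euc N → Euc N → ℝ)
    (hpc : ContinuousOn (fun z : Euc N × Euc N => p z.1 z.2) (Ω ×ˢ Ω))
    (m : ℝ) (hm : ∀ x ∈ Ω, ∀ y ∈ Ω, m ≤ p x y)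
    (hLH : LogHolderType Ω p) :
    ∃ ε > (0:ℝ), ∀ x ∈ Ω, ∀ y ∈ Ω, ∀ z ∈ Ω, dist y x < ε → dist z x < ε → p x x ≤ p y z := by
  obtain ⟨ε, hε, C, H⟩ := hLH
  refine ⟨ε, hε, fun x hx y hy z hz hyx hzx => ?_⟩
  have : Nonempty (Fin N) := ⟨⟨0, hN⟩⟩
  have : Nontrivial (Euc N) := inferInstance
  have hcl : (𝓝[≠] x).NeBot := inferInstance
  have hΩn : ∀ᶠ w in 𝓝[≠] x, w ∈ Ω := mem_nhdsWithin_of_mem_nhds (hop.mem_nhds hx)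
  have hd0 : Tendsto (fun w => dist x w) (𝓝[≠] x) (𝓝[>] 0) := by
    rw [tendsto_nhdsWithin_iff]
    constructor
    · have : Tendsto (fun w => dist x w) (𝓝 x) (𝓝 (dist x x)) := by
        apply Continuous.tendsto; fun_prop
      rw [dist_self] at this
      exact this.mono_left nhdsWithin_le_nhds
    · filter_upwards [self_mem_nhdsWithin] with w hw
      exact dist_pos.2 (Ne.symm hw)
  have hlog : Tendsto (fun w => Real.log (1 / dist x w)) (𝓝[≠] x) atTop := by
    have h1 : Tendsto (fun t : ℝ => Real.log (1 / t)) (𝓝[>] 0) atTop := by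
      have := Real.tendsto_log_atTop.comp (tendsto_inv_nhdsGT_zero (𝕜 := ℝ))
      simpa [Function.comp_def] using this
    exact h1.comp hd0
  have hlim : Tendsto (fun w => p x w) (𝓝[≠] x) (𝓝 (p x x)) := by
    have h1 : ContinuousAt (fun z : Euc N × Euc N => p z.1 z.2) (x, x) :=
      hpc.continuousAt ((hop.prod hop).mem_nhds ⟨hx, hx⟩)
    have h2 : Tendsto (fun w : Euc N => (x, w)) (𝓝 x) (𝓝 (x, x)) := by
      apply Continuous.tendsto; fun_prop
    exact (h1.tendsto.comp h2).mono_left nhdsWithin_le_nhds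
  have hrhs : Tendsto (fun w => p y z + C / Real.log (1 / dist x w)) (𝓝[≠] x) (𝓝 (p y z + 0)) :=
    tendsto_const_nhds.add (hlog.const_div_atTop C)
  rw [add_zero] at hrhs
  refine le_of_tendsto_of_tendsto hlim hrhs ?_
  have hzw : ∀ᶠ w in 𝓝[≠] x, dist z w < ε := by
    have : Tendsto (fun w => dist z w) (𝓝 x) (𝓝 (dist z x)) := by
      apply Continuous.tendsto; fun_prop
    exact (this.eventually (gt_mem_nhds hzx)).filter_mono nhdsWithin_le_nhds
  have hhalf : ∀ᶠ w in 𝓝[≠] x, dist x w < 1/2 := by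
    have := hd0.mono_right (nhdsWithin_le_nhds)
    exact this.eventually (gt_mem_nhds (by norm_num))
  filter_upwards [hΩn, hzw, hhalf, self_mem_nhdsWithin, hlog.eventually_gt_atTop 0]
    with w hw hzw hhalf hne hl
  have h1 := H x hx w hw (dist_pos.2 (Ne.symm hne)) hhalf
  have h2 : locInf Ω p ε x w ≤ p y z := by
    refine csInf_le ⟨m, ?_⟩ ⟨y, ⟨hyx, hy⟩, z, ⟨hzw, hz⟩, rfl⟩
    rintro _ ⟨a, ha, b, hb, rfl⟩
    exact hm a ha.2 b hb.2
  have h3 : |p x w - locInf Ω p ε x w| ≤ C / Real.log (1 / dist x w) := by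
    rwa [le_div_iff₀ hl]
  have h4 := le_abs_self (p x w - locInf Ω p ε x w)
  linarith

lemma aux_point {N : ℕ} (hN : 0 < N) (Ω A : Set (Euc N)) (hA : MeasurableSet A) (hAΩ : A ⊆ Ω)
    (p : Euc N → Euc N → ℝ) (s c κ r0 : ℝ) (hs : 0 < s) (hc : 1 < c) (hsc : s * c < N)
    (hκ : 0 < κ) (hr0 : 0 < r0) (hr01 : r0 ≤ 1)
    (hdens : ∀ x ∈ A, ∀ r, 0 < r → r ≤ r0 →
      ENNReal.ofReal (κ * r ^ N) ≤ volume (Metric.ball x r ∩ A))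
    (hP : ∀ x ∈ A, ∀ y ∈ A, dist x y < r0 → c ≤ p x y)
    (u : Euc N → ℝ) (x : Euc N) (hx : x ∈ A) (w M : ℝ) (hw : 1 ≤ w) (hM : 1 ≤ M)
    (hwt : w ^ (-c) ≤ κ * r0 ^ N / 2) (hux : 2 * w ≤ |u x|)
    (hE1 : volume.restrict A {y | w ≤ |u y|} ≤ ENNReal.ofReal (w ^ (-c)))
    (hE2 : volume.restrict A {y | w ≤ |u y|} ≤
      ENNReal.ofReal (M * w ^ (-((N:ℝ) * c / (N - s * c))))) :
    ENNReal.ofReal (w ^ ((N:ℝ) * c / (N - s * c))) ≤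
      ENNReal.ofReal ((2 / κ) * (2 * M / κ) ^ (s * c / N)) * ∫⁻ y in Ω, sobKernel s p u x y := by
  set P := (N:ℝ) * c / (N - s * c) with hPdef
  set θ := s * c / (N:ℝ) with hθ
  have hN' : (0:ℝ) < N := by exact_mod_cast hN
  have hNs : (0:ℝ) < N - s * c := by linarith
  have hPθ : c + P * θ = P := by
    have e : P * (N - s * c) = N * c := by rw [hPdef]; exact div_mul_cancel₀ _ hNs.ne'
    have e2 : θ * N = s * c := by rw [hθ]; field_simp
    have e3 : (c + P * θ - P) * N = 0 := by
      have : (c + P * θ - P) * N = c * N + P * (θ * N) - P * N := by ring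
      rw [this, e2]; linarith
    have := (mul_eq_zero.1 e3).resolve_right hN'.ne'
    linarith
  have hw0 : 0 < w := by linarith
  have hb0 : 0 < 2 * M / κ * w ^ (-P) := by positivity
  set r1 := (2 * M / κ * w ^ (-P)) ^ (1 / (N:ℝ)) with hr1
  have hr1p : 0 < r1 := by positivity
  have hr1N : r1 ^ N = 2 * M / κ * w ^ (-P) := by
    rw [hr1, one_div]; exact Real.rpow_inv_natCast_pow hb0.le hN.ne'
  set r := min r0 r1 with hr
  have hrp : 0 < r := lt_min hr0 hr1p
  have hE : volume.restrict A {y | w ≤ |u y|} ≤ ENNReal.ofReal (κ * r ^ N / 2) := by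
    rcases min_choice r0 r1 with h | h
    · rw [hr, h]; exact hE1.trans (ENNReal.ofReal_le_ofReal hwt)
    · rw [hr, h, hr1N]
      refine hE2.trans (ENNReal.ofReal_le_ofReal (le_of_eq ?_))
      field_simp
  set E' := toMeasurable (volume.restrict A) {y | w ≤ |u y|} with hE'
  have hE'm : MeasurableSet E' := measurableSet_toMeasurable _ _
  set F := (Metric.ball x r ∩ A) \ E' with hF
  have hFm : MeasurableSet F := (measurableSet_ball.inter hA).diff hE'm
  have hFvol : ENNReal.ofReal (κ * r ^ N / 2) ≤ volume F := by
    have h1 := hdens x hx r hrp (min_le_left _ _)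
    have h2 : volume (Metric.ball x r ∩ A) ≤ volume F + volume (E' ∩ A) := by
      refine (measure_mono ?_).trans (measure_union_le _ _)
      intro y hy
      by_cases h : y ∈ E'
      · exact Or.inr ⟨h, hy.2⟩
      · exact Or.inl ⟨hy, h⟩
    have h3 : volume (E' ∩ A) ≤ ENNReal.ofReal (κ * r ^ N / 2) := by
      rw [← Measure.restrict_apply hE'm, hE', measure_toMeasurable]; exact hE
    have h4 : ENNReal.ofReal (κ * r ^ N) =
        ENNReal.ofReal (κ * r ^ N / 2) + ENNReal.ofReal (κ * r ^ N / 2) := by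
      rw [← ENNReal.ofReal_add (by positivity) (by positivity)]; congr 1; ring
    have h5 : ENNReal.ofReal (κ * r ^ N / 2) + ENNReal.ofReal (κ * r ^ N / 2) ≤
        volume F + ENNReal.ofReal (κ * r ^ N / 2) := by
      rw [← h4]; exact h1.trans (h2.trans (by gcongr))
    exact (ENNReal.add_le_add_iff_right ENNReal.ofReal_ne_top).1 h5
  have hker : ∀ y ∈ F, ENNReal.ofReal (w ^ c / r ^ ((N:ℝ) + s * c)) ≤ sobKernel s p u x y := by
    intro y hy
    obtain ⟨⟨hyb, hyA⟩, hyE⟩ := hy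
    have hyu : |u y| < w := by
      by_contra h
      exact hyE (subset_toMeasurable _ _ (not_lt.1 h))
    have hD : w ≤ |u x - u y| := by
      have := abs_sub_abs_le_abs_sub (u x) (u y)
      linarith
    have hne : x ≠ y := by
      rintro rfl
      simp at hD; linarith
    have hd0 : 0 < dist x y := dist_pos.2 hne
    have hdr : dist x y < r := by rw [dist_comm]; exact hyb
    have hcp : c ≤ p x y := hP x hx y hyA (hdr.trans_le (min_le_left _ _))
    have hr1' : r ≤ 1 := (min_le_left _ _).trans hr01
    apply ENNReal.ofReal_le_ofReal
    have e1 : w ^ c ≤ |u x - u y| ^ p x y :=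
      (Real.rpow_le_rpow_of_exponent_le hw hcp).trans
        (Real.rpow_le_rpow hw0.le hD (by linarith))
    have e2 : dist x y ^ ((N:ℝ) + s * p x y) ≤ r ^ ((N:ℝ) + s * c) := by
      refine (Real.rpow_le_rpow hd0.le hdr.le ?_).trans
        (Real.rpow_le_rpow_of_exponent_ge hrp hr1' ?_)
      · have : 0 < s * p x y := by apply mul_pos hs; linarith
        linarith
      · gcongr
    have e3 : 0 < dist x y ^ ((N:ℝ) + s * p x y) := Real.rpow_pos_of_pos hd0 _
    gcongr
  have hG : ENNReal.ofReal (w ^ c / r ^ ((N:ℝ) + s * c)) * ENNReal.ofReal (κ * r ^ N / 2) ≤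
      ∫⁻ y in Ω, sobKernel s p u x y := by
    calc _ ≤ ENNReal.ofReal (w ^ c / r ^ ((N:ℝ) + s * c)) * volume F := by gcongr
      _ = ∫⁻ y in F, ENNReal.ofReal (w ^ c / r ^ ((N:ℝ) + s * c)) := by
        rw [setLIntegral_const]
      _ ≤ ∫⁻ y in F, sobKernel s p u x y := setLIntegral_mono' hFm hker
      _ ≤ _ := lintegral_mono_set (fun y hy => hAΩ hy.1.2)
  refine le_trans ?_ (mul_le_mul_right hG _)
  rw [← ENNReal.ofReal_mul (by positivity), ← ENNReal.ofReal_mul (by positivity)]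
  apply ENNReal.ofReal_le_ofReal
  have k1 : r1 ^ (s * c) = (2 * M / κ) ^ θ * w ^ (-(P * θ)) := by
    rw [hr1, ← Real.rpow_mul hb0.le, Real.mul_rpow (by positivity) (by positivity),
      ← Real.rpow_mul hw0.le]
    have : 1 / (N:ℝ) * (s * c) = θ := by rw [hθ]; ring
    rw [this, neg_mul]
  have k2 : r ^ (s * c) ≤ r1 ^ (s * c) :=
    Real.rpow_le_rpow hrp.le (min_le_right _ _) (by positivity)
  have k3 : r ^ ((N:ℝ) + s * c) = r ^ N * r ^ (s * c) := by
    rw [Real.rpow_add hrp, Real.rpow_natCast]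
  have k4 : (2 / κ) * (2 * M / κ) ^ θ * (w ^ c / r ^ ((N:ℝ) + s * c) * (κ * r ^ N / 2)) =
      (2 * M / κ) ^ θ * w ^ c / r ^ (s * c) := by
    rw [k3]; field_simp
  rw [k4, le_div_iff₀ (by positivity)]
  calc w ^ P * r ^ (s * c) ≤ w ^ P * ((2 * M / κ) ^ θ * w ^ (-(P * θ))) := by
        rw [← k1]; gcongr
    _ = (2 * M / κ) ^ θ * (w ^ P * w ^ (-(P * θ))) := by ring
    _ = (2 * M / κ) ^ θ * w ^ c := by
        rw [← Real.rpow_add hw0]; congr 2; linarith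

lemma aux_cheb {N : ℕ} (A : Set (Euc N)) (f : Euc N → ℝ)
    (hf : AEMeasurable f (volume.restrict A)) (w a B : ℝ) (hw : 0 < w)
    (ha : 0 < a)
    (hB : ∫⁻ y in A, ENNReal.ofReal (f y ^ a) ≤ ENNReal.ofReal B) :
    volume.restrict A {y | w ≤ f y} ≤ ENNReal.ofReal (B * w ^ (-a)) := by
  have h1 : AEMeasurable (fun y => ENNReal.ofReal (f y ^ a)) (volume.restrict A) :=
    (hf.pow_const a).ennreal_ofReal
  have h2 := meas_ge_le_lintegral_div h1 (ε := ENNReal.ofReal (w ^ a))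
    (by simpa using Real.rpow_pos_of_pos hw a) ENNReal.ofReal_ne_top
  have h3 : {y | w ≤ f y} ⊆ {y | ENNReal.ofReal (w ^ a) ≤ ENNReal.ofReal (f y ^ a)} := by
    intro y hy
    exact ENNReal.ofReal_le_ofReal (Real.rpow_le_rpow hw.le hy ha.le)
  refine (measure_mono h3).trans (h2.trans ?_)
  rw [Real.rpow_neg hw.le, ← div_eq_mul_inv, ENNReal.ofReal_div_of_pos (by positivity)]
  gcongr

lemma aux_core {N : ℕ} (hN : 0 < N) (Ω A : Set (Euc N)) (hA : MeasurableSet A) (hAΩ : A ⊆ Ω)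
    (hAfin : volume A ≠ ⊤)
    (p : Euc N → Euc N → ℝ) (s c κ r0 : ℝ) (hs : 0 < s) (hc : 1 < c) (hsc : s * c < N)
    (hκ : 0 < κ) (hr0 : 0 < r0) (hr01 : r0 ≤ 1)
    (hdens : ∀ x ∈ A, ∀ r, 0 < r → r ≤ r0 →
      ENNReal.ofReal (κ * r ^ N) ≤ volume (Metric.ball x r ∩ A))
    (hP : ∀ x ∈ A, ∀ y ∈ A, dist x y < r0 → c ≤ p x y)
    (hpd : ∀ x ∈ A, p x x = c) :
    ∃ K : ℝ, ∀ u : Euc N → ℝ, AEStronglyMeasurable u (volume.restrict Ω) →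
      sobModular Ω s p u ≤ 1 →
      ∫⁻ x in A, ENNReal.ofReal (|u x| ^ ((N:ℝ) * c / (N - s * c))) ≤ ENNReal.ofReal K := by
  set P := (N:ℝ) * c / (N - s * c) with hPdef
  set θ := s * c / (N:ℝ) with hθ
  have hN' : (0:ℝ) < N := by exact_mod_cast hN
  have hNs : (0:ℝ) < N - s * c := by linarith
  have hPpos : 0 < P := by positivity
  have hθ0 : 0 < θ := by positivity
  have hθ1 : θ < 1 := by rw [hθ, div_lt_one hN']; exact hsc
  set t0 := max 1 (2 / (κ * r0 ^ N)) with ht0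
  have ht01 : 1 ≤ t0 := le_max_left _ _
  set K0 := (2 * t0) ^ P with hK0
  have hK0p : 0 < K0 := by positivity
  set B := 2 ^ P * ((2 / κ) * (2 / κ) ^ θ) with hB
  have hBp : 0 < B := by positivity
  set K1 := 1 + K0 * (volume A).toReal + B with hK1
  have hK1p : 0 < K1 := by positivity
  refine ⟨K1 ^ (1 / (1 - θ)), fun u hu hmod => ?_⟩
  have huA : AEMeasurable u (volume.restrict A) :=
    (hu.mono_measure (Measure.restrict_mono hAΩ le_rfl)).aemeasurable
  have habs : AEMeasurable (fun y => |u y|) (volume.restrict A) := huA.abs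
  have hm1 : ∫⁻ x in A, ENNReal.ofReal (|u x| ^ c) ≤ ENNReal.ofReal 1 := by
    rw [ENNReal.ofReal_one]
    calc ∫⁻ x in A, ENNReal.ofReal (|u x| ^ c)
        = ∫⁻ x in A, ENNReal.ofReal (|u x| ^ (p x x)) :=
          setLIntegral_congr_fun hA (fun x hx => by simp only [hpd x hx])
      _ ≤ ∫⁻ x in Ω, ENNReal.ofReal (|u x| ^ (p x x)) := lintegral_mono_set hAΩ
      _ ≤ 1 := le_trans le_self_add hmod
  have hm2 : ∫⁻ x in A, ∫⁻ y in Ω, sobKernel s p u x y ≤ 1 :=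
    (lintegral_mono_set hAΩ).trans (le_trans le_add_self hmod)
  -- truncated estimate
  have trunc : ∀ n : ℕ, ∫⁻ x in A, ENNReal.ofReal ((min |u x| n) ^ P) ≤
      ENNReal.ofReal (K1 ^ (1 / (1 - θ))) := by
    intro n
    set v : Euc N → ℝ := fun x => min |u x| n with hv
    have hv0 : ∀ x, 0 ≤ v x := fun x => le_min (abs_nonneg _) (Nat.cast_nonneg _)
    have hvm : AEMeasurable v (volume.restrict A) := habs.min aemeasurable_const
    set I := ∫⁻ x in A, ENNReal.ofReal ((v x) ^ P) with hI
    have hIfin : I ≠ ⊤ := by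
      have : I ≤ ENNReal.ofReal ((n:ℝ) ^ P) * volume A := by
        rw [← setLIntegral_const]
        exact lintegral_mono (fun x => ENNReal.ofReal_le_ofReal
          (Real.rpow_le_rpow (hv0 x) (min_le_right _ _) hPpos.le))
      exact ne_top_of_le_ne_top (ENNReal.mul_ne_top ENNReal.ofReal_ne_top hAfin) this
    set M := I.toReal + 1 with hM
    have hM1 : 1 ≤ M := by
      have : 0 ≤ I.toReal := ENNReal.toReal_nonneg
      linarith
    have hIM : I ≤ ENNReal.ofReal M := by
      rw [← ENNReal.ofReal_toReal hIfin]
      exact ENNReal.ofReal_le_ofReal (by linarith)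
    have hpt : ∀ x ∈ A, ENNReal.ofReal ((v x) ^ P) ≤ ENNReal.ofReal K0 +
        ENNReal.ofReal (B * M ^ θ) * ∫⁻ y in Ω, sobKernel s p u x y := by
      intro x hx
      by_cases hvx : v x ≤ 2 * t0
      · refine le_trans (ENNReal.ofReal_le_ofReal ?_) le_self_add
        exact Real.rpow_le_rpow (hv0 x) hvx hPpos.le
      · rw [not_le] at hvx
        set w := v x / 2 with hw
        have hwt0 : t0 ≤ w := by rw [hw]; linarith
        have hw1 : 1 ≤ w := ht01.trans hwt0
        have hwp : 0 < w := by linarith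
        have hwt : w ^ (-c) ≤ κ * r0 ^ N / 2 := by
          have e1 : 2 / (κ * r0 ^ N) ≤ w := (le_max_right _ _).trans hwt0
          calc w ^ (-c) ≤ w ^ (-1:ℝ) := Real.rpow_le_rpow_of_exponent_le hw1 (by linarith)
            _ = w⁻¹ := Real.rpow_neg_one w
            _ ≤ (2 / (κ * r0 ^ N))⁻¹ := inv_anti₀ (by positivity) e1
            _ = κ * r0 ^ N / 2 := by rw [inv_div]
        have hux : 2 * w ≤ |u x| := by
          have : 2 * w = v x := by rw [hw]; ring
          rw [this]; exact min_le_left _ _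
        have hwn : w ≤ n := by
          have h1 : v x ≤ n := min_le_right _ _
          have : 2 * w = v x := by rw [hw]; ring
          linarith
        have hE1 : volume.restrict A {y | w ≤ |u y|} ≤ ENNReal.ofReal (w ^ (-c)) := by
          have := aux_cheb A (fun y => |u y|) habs w c 1 hwp
            (by linarith) hm1
          rwa [one_mul] at this
        have hE2 : volume.restrict A {y | w ≤ |u y|} ≤ ENNReal.ofReal (M * w ^ (-P)) := by
          have := aux_cheb A v hvm w P M hwp hPpos hIM
          refine le_trans (measure_mono ?_) this
          intro y hy
          exact le_min hy hwn
        have key := aux_point hN Ω A hA hAΩ p s c κ r0 hs hc hsc hκ hr0 hr01 hdens hP u x hx w M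
          hw1 hM1 hwt hux hE1 hE2
        have e1 : (v x) ^ P = 2 ^ P * w ^ P := by
          rw [← Real.mul_rpow (by norm_num) hwp.le]; congr 1; rw [hw]; ring
        have e2 : B * M ^ θ = 2 ^ P * ((2 / κ) * (2 * M / κ) ^ θ) := by
          have : 2 * M / κ = 2 / κ * M := by ring
          rw [this, Real.mul_rpow (by positivity) (by positivity), hB]; ring
        refine le_trans ?_ le_add_self
        rw [e1, e2, ENNReal.ofReal_mul (by positivity), ENNReal.ofReal_mul (p := 2 ^ P) (by positivity),
          mul_assoc]
        gcongr
    have hint : I ≤ ENNReal.ofReal (K0 * (volume A).toReal + B * M ^ θ) := by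
      calc I ≤ ∫⁻ x in A, (ENNReal.ofReal K0 +
            ENNReal.ofReal (B * M ^ θ) * ∫⁻ y in Ω, sobKernel s p u x y) :=
            setLIntegral_mono' hA hpt
        _ = ENNReal.ofReal K0 * volume A +
            ENNReal.ofReal (B * M ^ θ) * ∫⁻ x in A, ∫⁻ y in Ω, sobKernel s p u x y := by
            rw [lintegral_add_left measurable_const, setLIntegral_const,
              lintegral_const_mul' _ _ ENNReal.ofReal_ne_top]
        _ ≤ ENNReal.ofReal K0 * ENNReal.ofReal (volume A).toReal +
            ENNReal.ofReal (B * M ^ θ) * 1 := by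
            rw [ENNReal.ofReal_toReal hAfin]; gcongr
        _ = _ := by
            rw [mul_one, ← ENNReal.ofReal_mul hK0p.le, ← ENNReal.ofReal_add] <;> positivity
    have hint' : I.toReal ≤ K0 * (volume A).toReal + B * M ^ θ :=
      ENNReal.toReal_le_of_le_ofReal (by positivity) hint
    have hMθ : 1 ≤ M ^ θ := Real.one_le_rpow hM1 hθ0.le
    have hMK : M ≤ K1 * M ^ θ := by
      have h1 : K0 * (volume A).toReal ≤ K0 * (volume A).toReal * M ^ θ :=
        le_mul_of_one_le_right (by positivity) hMθ
      rw [hK1]; nlinarith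
    have hM0 : 0 < M := by linarith
    have hM2 : M ^ (1 - θ) ≤ K1 := by
      rw [Real.rpow_sub hM0, Real.rpow_one, div_le_iff₀ (by positivity)]; exact hMK
    have hM3 : M ≤ K1 ^ (1 / (1 - θ)) := by
      have h1 : (M ^ (1 - θ)) ^ (1 / (1 - θ)) ≤ K1 ^ (1 / (1 - θ)) :=
        Real.rpow_le_rpow (by positivity) hM2 (one_div_nonneg.2 (by linarith))
      rwa [← Real.rpow_mul hM0.le, mul_one_div_cancel (by linarith), Real.rpow_one] at h1
    exact hIM.trans (ENNReal.ofReal_le_ofReal hM3)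
  -- Fatou
  have hlim : ∀ x, ENNReal.ofReal (|u x| ^ P) ≤
      liminf (fun n : ℕ => ENNReal.ofReal ((min |u x| n) ^ P)) atTop := by
    intro x
    obtain ⟨n0, hn0⟩ := exists_nat_ge |u x|
    refine le_liminf_of_le (by isBoundedDefault) ?_
    filter_upwards [eventually_ge_atTop n0] with n hn
    rw [min_eq_left (hn0.trans (by exact_mod_cast hn))]
  calc ∫⁻ x in A, ENNReal.ofReal (|u x| ^ P)
      ≤ ∫⁻ x in A, liminf (fun n : ℕ => ENNReal.ofReal ((min |u x| n) ^ P)) atTop :=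
        lintegral_mono hlim
    _ ≤ liminf (fun n : ℕ => ∫⁻ x in A, ENNReal.ofReal ((min |u x| n) ^ P)) atTop :=
        lintegral_liminf_le' (fun n => ((habs.min aemeasurable_const).pow_const P).ennreal_ofReal)
    _ ≤ _ := by
        refine liminf_le_of_frequently_le' (Frequently.of_forall trunc)

lemma aux_scale (a c h : ℝ) (hc : 1 ≤ c) (hh : 1 ≤ h) : |a / c| ^ h ≤ c⁻¹ * |a| ^ h := by
  have hc0 : 0 < c := by linarith
  rw [abs_div, abs_of_pos hc0, Real.div_rpow (abs_nonneg _) hc0.le, div_eq_mul_inv, mul_comm]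
  gcongr
  calc c = c ^ (1:ℝ) := (Real.rpow_one c).symm
    _ ≤ c ^ h := Real.rpow_le_rpow_of_exponent_le hc hh

lemma aux_varscale {N : ℕ} (Ω : Set (Euc N)) (hΩ : MeasurableSet Ω) (h u : Euc N → ℝ)
    (hh : ∀ x ∈ Ω, 1 ≤ h x) (c : ℝ) (hc : 1 ≤ c) :
    varModular (volume.restrict Ω) h (fun x => u x / c) ≤
      ENNReal.ofReal c⁻¹ * varModular (volume.restrict Ω) h u := by
  have hc0 : 0 < c := by linarith
  unfold varModular
  rw [← lintegral_const_mul' _ _ ENNReal.ofReal_ne_top]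
  refine setLIntegral_mono' hΩ (fun x hx => ?_)
  rw [← ENNReal.ofReal_mul (by positivity)]
  exact ENNReal.ofReal_le_ofReal (aux_scale _ _ _ hc (hh x hx))

lemma aux_sobscale {N : ℕ} (Ω : Set (Euc N)) (hΩ : MeasurableSet Ω) (s : ℝ)
    (p : Euc N → Euc N → ℝ) (u : Euc N → ℝ)
    (hp : ∀ x ∈ Ω, ∀ y ∈ Ω, 1 ≤ p x y) (c : ℝ) (hc : 1 ≤ c) :
    sobModular Ω s p (fun x => u x / c) ≤ ENNReal.ofReal c⁻¹ * sobModular Ω s p u := by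
  have hc0 : 0 < c := by linarith
  unfold sobModular
  rw [mul_add]
  refine add_le_add (aux_varscale Ω hΩ (fun x => p x x) u (fun x hx => hp x hx x hx) c hc) ?_
  rw [← lintegral_const_mul' _ _ ENNReal.ofReal_ne_top]
  refine setLIntegral_mono' hΩ (fun x hx => ?_)
  rw [← lintegral_const_mul' _ _ ENNReal.ofReal_ne_top]
  refine setLIntegral_mono' hΩ (fun y hy => ?_)
  unfold sobKernel
  rw [← ENNReal.ofReal_mul (by positivity)]
  refine ENNReal.ofReal_le_ofReal ?_
  rw [← sub_div, ← mul_div_assoc]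
  have := aux_scale (u x - u y) c (p x y) hc (hp x hx y hy)
  gcongr

/-- Theorem 3.4, bounded domain case: critical Sobolev-type imbedding
`W^{s,p(·,·)}(Ω) ↪ L^{q(·)}(Ω)` on a bounded Lipschitz domain. -/
theorem critical_imbedding_bounded_domain {N : ℕ} (Ω : Set (Euc N))
    (hΩ : IsBoundedLipschitzDomain Ω)
    (s : ℝ) (hs : s ∈ Set.Ioo (0 : ℝ) 1)
    (p : Euc N → Euc N → ℝ)
    (hpuc : UniformContinuousOn (fun z : Euc N × Euc N => p z.1 z.2)
      (closure Ω ×ˢ closure Ω))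
    (hpsym : ∀ x y, p x y = p y x)
    (pminus pplus : ℝ)
    (hpminus : IsGLB {a : ℝ | ∃ x ∈ closure Ω, ∃ y ∈ closure Ω, a = p x y} pminus)
    (hpplus : IsLUB {a : ℝ | ∃ x ∈ closure Ω, ∃ y ∈ closure Ω, a = p x y} pplus)
    (hpm1 : 1 < pminus) (hppN : pplus < (N : ℝ) / s)
    (hLH : LogHolderType Ω p)
    (q : Euc N → ℝ) (hqc : ContinuousOn q (closure Ω))
    (qminus qplus : ℝ)
    (hqm : ∀ x ∈ closure Ω, qminus ≤ q x) (hqp : ∀ x ∈ closure Ω, q x ≤ qplus)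
    (hqm1 : 1 < qminus)
    (hq : ∀ x ∈ Ω, ∃ ε > (0 : ℝ), ∀ y ∈ Metric.ball x ε ∩ Ω,
      q y ≤ (N : ℝ) * locInf Ω p ε x x / ((N : ℝ) - s * locInf Ω p ε x x)) :
    ∃ C > (0 : ℝ), ∀ u : Euc N → ℝ, MemSob Ω s p u →
      MemVarLp (volume.restrict Ω) q u ∧
      luxNorm (volume.restrict Ω) q u ≤ C * sobNorm Ω s p u := by
  have hΩ' := hΩ
  obtain ⟨hop, hbd, hne, -⟩ := hΩ'
  have hΩm : MeasurableSet Ω := hop.measurableSet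
  have hlo : ∀ x ∈ closure Ω, ∀ y ∈ closure Ω, pminus ≤ p x y :=
    fun x hx y hy => hpminus.1 ⟨x, hx, y, hy, rfl⟩
  have hhi : ∀ x ∈ closure Ω, ∀ y ∈ closure Ω, p x y ≤ pplus :=
    fun x hx y hy => hpplus.1 ⟨x, hx, y, hy, rfl⟩
  have hlo' : ∀ x ∈ Ω, ∀ y ∈ Ω, pminus ≤ p x y :=
    fun x hx y hy => hlo x (subset_closure hx) y (subset_closure hy)
  have hhi' : ∀ x ∈ Ω, ∀ y ∈ Ω, p x y ≤ pplus :=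
    fun x hx y hy => hhi x (subset_closure hx) y (subset_closure hy)
  obtain ⟨hs0, hs1⟩ := hs
  have hN : 0 < N := by
    rcases Nat.eq_zero_or_pos N with h | h
    · exfalso
      obtain ⟨x, hx⟩ := hne
      have h1 := hlo' x hx x hx
      have h2 := hhi' x hx x hx
      have h3 : (N:ℝ) / s = 0 := by rw [h]; simp
      linarith
    · exact h
  have hsp : ∀ x ∈ Ω, ∀ y ∈ Ω, s * p x y < N := by
    intro x hx y hy
    have := (hhi' x hx y hy).trans_lt hppN
    rwa [lt_div_iff₀ hs0, mul_comm] at this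
  obtain ⟨ε, hε, hmin⟩ := aux_exponent hN Ω hop p
    (hpuc.continuousOn.mono (Set.prod_mono subset_closure subset_closure)) pminus hlo' hLH
  have hconst : ∀ x ∈ Ω, ∀ y ∈ Ω, dist y x < ε → p y y = p x x := by
    intro x hx y hy h
    refine le_antisymm ?_ (hmin x hx y hy y hy h h)
    rw [dist_comm] at h
    exact hmin y hy x hx x hx h h
  obtain ⟨r0, hr0, κ, hκ, hdens⟩ := aux_density Ω hΩ
  set R := min (r0 / 2) (min (ε / 2) 1) with hR
  have hRp : 0 < R := by positivity
  have hRr : R < r0 := (min_le_left _ _).trans_lt (by linarith)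
  have hRε : R < ε := ((min_le_right _ _).trans (min_le_left _ _)).trans_lt (by linarith)
  have hR1 : R ≤ 1 := (min_le_right _ _).trans (min_le_right _ _)
  have hΩfin : volume Ω ≠ ⊤ := hbd.measure_lt_top.ne
  set V := (volume (Metric.ball (0 : Euc N) 1)) with hV
  have hVfin : V ≠ ⊤ := measure_ball_lt_top.ne
  have hVpos : 0 < V.toReal :=
    ENNReal.toReal_pos (Metric.measure_ball_pos volume _ one_pos).ne' hVfin
  have hlocal : ∀ x0 ∈ Ω, ∃ K : ℝ, ∀ u : Euc N → ℝ,
      AEStronglyMeasurable u (volume.restrict Ω) → sobModular Ω s p u ≤ 1 →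
      ∫⁻ x in Metric.ball x0 ε ∩ Ω, ENNReal.ofReal (|u x| ^ q x) ≤ ENNReal.ofReal K := by
    intro x0 hx0
    set c := p x0 x0 with hc
    have hc1 : 1 < c := hpm1.trans_le (hlo' x0 hx0 x0 hx0)
    have hsc : s * c < N := hsp x0 hx0 x0 hx0
    set A := {x | x ∈ Ω ∧ p x x = c} with hAdef
    have hAΩ : A ⊆ Ω := fun x hx => hx.1
    have hball : ∀ x ∈ A, Metric.ball x ε ∩ Ω ⊆ A := fun x hx y hy =>
      ⟨hy.2, (hconst x hx.1 y hy.2 hy.1).trans hx.2⟩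
    have hAo : IsOpen A := by
      rw [isOpen_iff_mem_nhds]
      intro x hx
      exact Filter.mem_of_superset
        (Filter.inter_mem (Metric.ball_mem_nhds x hε) (hop.mem_nhds hx.1)) (hball x hx)
    have hAfin : volume A ≠ ⊤ := ne_top_of_le_ne_top hΩfin (measure_mono hAΩ)
    have hd : ∀ x ∈ A, ∀ r, 0 < r → r ≤ R →
        ENNReal.ofReal (κ ^ N * V.toReal * r ^ N) ≤ volume (Metric.ball x r ∩ A) := by
      intro x hx r hr hrR
      obtain ⟨y, hy⟩ := hdens x hx.1 r hr (hrR.trans_lt hRr)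
      have hsub : Metric.ball y (κ * r) ⊆ Metric.ball x r ∩ A := fun z hz =>
        ⟨(hy hz).1, hball x hx ⟨Metric.ball_subset_ball (hrR.trans hRε.le) (hy hz).1, (hy hz).2⟩⟩
      refine le_trans (le_of_eq ?_) (measure_mono hsub)
      rw [Measure.addHaar_ball_of_pos _ _ (by positivity), finrank_euclideanSpace, Fintype.card_fin,
        ← hV, ← ENNReal.ofReal_toReal hVfin, ← ENNReal.ofReal_mul (by positivity),
        ENNReal.toReal_ofReal hVpos.le]
      congr 1; ring
    have hPP : ∀ x ∈ A, ∀ y ∈ A, dist x y < R → c ≤ p x y := by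
      intro x hx y hy hxy
      rw [← hx.2]
      refine hmin x hx.1 x hx.1 y hy.1 (by simpa using hε) ?_
      rw [dist_comm]; exact hxy.trans hRε
    obtain ⟨K, hK⟩ := aux_core hN Ω A hAo.measurableSet hAΩ hAfin p s c (κ ^ N * V.toReal) R hs0
      hc1 hsc (by positivity) hRp hR1 hd hPP (fun x hx => hx.2)
    refine ⟨(volume A).toReal + max K 0, fun u hu hmod => ?_⟩
    have h1 := hK u hu hmod
    have hN' : (0:ℝ) < N := by exact_mod_cast hN
    set P := (N:ℝ) * c / (N - s * c) with hP
    have hqP : ∀ x ∈ A, q x ≤ P := by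
      intro x hx
      obtain ⟨δ, hδ, H⟩ := hq x hx.1
      have h2 := H x ⟨Metric.mem_ball_self hδ, hx.1⟩
      refine h2.trans ?_
      have hL : locInf Ω p δ x x ≤ c := by
        rw [← hx.2]
        refine csInf_le ⟨pminus, ?_⟩ ⟨x, ⟨Metric.mem_ball_self hδ, hx.1⟩, x,
          ⟨Metric.mem_ball_self hδ, hx.1⟩, rfl⟩
        rintro _ ⟨a, ha, b, hb, rfl⟩
        exact hlo' a ha.2 b hb.2
      have hsL : s * locInf Ω p δ x x ≤ s * c := by gcongr
      rw [hP, div_le_div_iff₀ (by linarith) (by linarith)]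
      nlinarith [mul_nonneg (sq_nonneg (N:ℝ)) (sub_nonneg.2 hL)]
    calc ∫⁻ x in Metric.ball x0 ε ∩ Ω, ENNReal.ofReal (|u x| ^ q x)
        ≤ ∫⁻ x in A, ENNReal.ofReal (|u x| ^ q x) :=
          lintegral_mono_set (hball x0 ⟨hx0, rfl⟩)
      _ ≤ ∫⁻ x in A, (1 + ENNReal.ofReal (|u x| ^ P)) := by
          refine setLIntegral_mono' hAo.measurableSet (fun x hx => ?_)
          have hq0 : 0 ≤ q x := by linarith [hqm x (subset_closure hx.1)]
          rcases le_total |u x| 1 with h | h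
          · refine le_trans ?_ le_self_add
            rw [← ENNReal.ofReal_one]
            exact ENNReal.ofReal_le_ofReal (Real.rpow_le_one (abs_nonneg _) h hq0)
          · refine le_trans ?_ le_add_self
            exact ENNReal.ofReal_le_ofReal (Real.rpow_le_rpow_of_exponent_le h (hqP x hx))
      _ = volume A + ∫⁻ x in A, ENNReal.ofReal (|u x| ^ P) := by
          rw [lintegral_add_left measurable_const, setLIntegral_const, one_mul]
      _ ≤ ENNReal.ofReal (volume A).toReal + ENNReal.ofReal (max K 0) := by
          rw [ENNReal.ofReal_toReal hAfin]
          gcongr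
          exact h1.trans (ENNReal.ofReal_le_ofReal (le_max_left _ _))
      _ = _ := by
          rw [ENNReal.ofReal_add ENNReal.toReal_nonneg (le_max_right _ _)]
  have hglobal : ∃ K : ℝ, 1 ≤ K ∧ ∀ u : Euc N → ℝ,
      AEStronglyMeasurable u (volume.restrict Ω) → sobModular Ω s p u ≤ 1 →
      varModular (volume.restrict Ω) q u ≤ ENNReal.ofReal K := by
    choose! K hK using hlocal
    obtain ⟨t, htΩ, htfin, htcov⟩ :=
      Metric.finite_approx_of_totallyBounded (hbd.isCompact_closure.totallyBounded.subset subset_closure) ε hε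
    lift t to Finset (Euc N) using htfin
    refine ⟨max 1 (∑ y ∈ t, max (K y) 0), le_max_left _ _, fun u hu hmod => ?_⟩
    unfold varModular
    calc ∫⁻ x in Ω, ENNReal.ofReal (|u x| ^ q x)
        ≤ ∫⁻ x in ⋃ y ∈ t, Metric.ball y ε ∩ Ω, ENNReal.ofReal (|u x| ^ q x) := by
          refine lintegral_mono_set (fun x hx => ?_)
          have := htcov hx
          simp only [Set.mem_iUnion, Finset.mem_coe] at this ⊢
          obtain ⟨y, hy, hxy⟩ := this
          exact ⟨y, hy, hxy, hx⟩
      _ ≤ ∑ y ∈ t, ∫⁻ x in Metric.ball y ε ∩ Ω, ENNReal.ofReal (|u x| ^ q x) := by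
          refine (le_trans (lintegral_mono' (Measure.restrict_biUnion_le (T := (t : Set (Euc N)))
            t.countable_toSet) le_rfl) ?_)
          rw [lintegral_sum_measure]
          exact (Finset.tsum_subtype t
            (fun y => ∫⁻ x in Metric.ball y ε ∩ Ω, ENNReal.ofReal (|u x| ^ q x))).le
      _ ≤ ∑ y ∈ t, ENNReal.ofReal (max (K y) 0) := by
          refine Finset.sum_le_sum (fun y hy => ?_)
          exact (hK y (htΩ hy) u hu hmod).trans (ENNReal.ofReal_le_ofReal (le_max_left _ _))
      _ = ENNReal.ofReal (∑ y ∈ t, max (K y) 0) :=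
          (ENNReal.ofReal_sum_of_nonneg (fun y _ => le_max_right _ _)).symm
      _ ≤ _ := ENNReal.ofReal_le_ofReal (le_max_right _ _)
  obtain ⟨K, hK1, hK⟩ := hglobal
  have hKp : 0 < K := by linarith
  have hp1 : ∀ x ∈ Ω, ∀ y ∈ Ω, 1 ≤ p x y := fun x hx y hy => hpm1.le.trans (hlo' x hx y hy)
  have hq1 : ∀ x ∈ Ω, 1 ≤ q x := fun x hx => hqm1.le.trans (hqm x (subset_closure hx))
  refine ⟨K, hKp, fun u hu => ?_⟩
  obtain ⟨hum, hufin⟩ := hu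
  have humc : ∀ c : ℝ, AEStronglyMeasurable (fun x => u x / c) (volume.restrict Ω) := by
    intro c
    simp only [div_eq_mul_inv]
    exact hum.mul_const _
  -- an admissible constant
  obtain ⟨c0, hc01, hc0⟩ : ∃ c : ℝ, 1 ≤ c ∧ sobModular Ω s p (fun x => u x / c) ≤ 1 := by
    set c := max 1 (sobModular Ω s p u).toReal with hc
    have hc1 : 1 ≤ c := le_max_left _ _
    have hcp : 0 < c := by linarith
    refine ⟨c, hc1, (aux_sobscale Ω hΩm s p u hp1 c hc1).trans ?_⟩
    rw [← ENNReal.ofReal_toReal hufin.ne, ← ENNReal.ofReal_mul (by positivity),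
      ← ENNReal.ofReal_one]
    refine ENNReal.ofReal_le_ofReal ?_
    rw [inv_mul_le_iff₀ hcp, mul_one]
    exact le_max_right _ _
  refine ⟨⟨hum, ?_⟩, ?_⟩
  · have hc0p : 0 < c0 := by linarith
    have h1 := hK _ (humc c0) hc0
    have h2 : varModular (volume.restrict Ω) q u ≤ ENNReal.ofReal (c0 ^ qplus) *
        varModular (volume.restrict Ω) q (fun x => u x / c0) := by
      unfold varModular
      rw [← lintegral_const_mul' _ _ ENNReal.ofReal_ne_top]
      refine setLIntegral_mono' hΩm (fun x hx => ?_)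
      rw [← ENNReal.ofReal_mul (by positivity)]
      refine ENNReal.ofReal_le_ofReal ?_
      have e : |u x| = c0 * |u x / c0| := by
        rw [abs_div, abs_of_pos hc0p]; field_simp
      rw [e, Real.mul_rpow hc0p.le (abs_nonneg _)]
      have := Real.rpow_le_rpow_of_exponent_le hc01 (hqp x (subset_closure hx))
      have e2 : u x / c0 = (u x / c0) := rfl
      gcongr
    exact h2.trans_lt (ENNReal.mul_lt_top ENNReal.ofReal_lt_top
      (h1.trans_lt ENNReal.ofReal_lt_top))
  · have hstep : ∀ c ∈ {c : ℝ | 0 < c ∧ sobModular Ω s p (fun x => u x / c) ≤ 1},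
        luxNorm (volume.restrict Ω) q u / K ≤ c := by
      rintro c ⟨hcp, hc⟩
      rw [div_le_iff₀ hKp]
      refine csInf_le ⟨0, fun a ha => ha.1.le⟩ ⟨by positivity, ?_⟩
      have h1 := hK _ (humc c) hc
      have h2 := aux_varscale Ω hΩm q (fun x => u x / c) hq1 K hK1
      have h3 : (fun x => u x / (c * K)) = fun x => (u x / c) / K := by
        funext x; rw [div_div]
      rw [h3]
      refine h2.trans ((mul_le_mul_right h1 _).trans ?_)
      rw [← ENNReal.ofReal_mul (by positivity), inv_mul_cancel₀ hKp.ne', ENNReal.ofReal_one]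
    have hne' : Set.Nonempty {c : ℝ | 0 < c ∧ sobModular Ω s p (fun x => u x / c) ≤ 1} :=
      ⟨c0, by linarith, hc0⟩
    have h := le_csInf hne' hstep
    rw [div_le_iff₀ hKp] at h
    rw [mul_comm]
    exact h
end
end

section
/- Let s ∈ (0,1) and p: ℝ^N×ℝ^N → ℝ be uniformly continuous and symmetric (p(x,y)=p(y,x)) with 1 < inf p ≤ sup p < N/s, satisfying the log-Hölder type continuity condition: inf_{ε>0} sup{ |p(x,y) − inf_{B_ε(x)×B_ε(y)} p| · log(1/|x−y|) : x,y ∈ ℝ^N, 0 < |x−y| < 1/2 } < ∞. Let q: ℝ^N → ℝ be uniformly continuous with 1 < inf q ≤ sup q < ∞ and p(x,x) < q(x) for all x ∈ ℝ^N, and such that for every x ∈ ℝ^N there exists ε > 0 with sup_{y∈B_ε(x)} q(y) ≤ N·p_ε/(N − s·p_ε), where p_ε := inf_{(y,z)∈B_ε(x)×B_ε(x)} p(y,z). Then W^{s,p(·,·)}(ℝ^N) embeds continuously into L^{q(·)}(ℝ^N): there exists C > 0 such that ‖u‖_{L^{q(·)}(ℝ^N)} ≤ C‖u‖_{s,p}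 for all u ∈ W^{s,p(·,·)}(ℝ^N). -/
open MeasureTheory Filter Topology Set
open scoped ENNReal NNReal

noncomputable section

lemma aux_diag {N : ℕ} (hN : 0 < N) (p : Euc N → Euc N → ℝ)
    (hpc : Continuous fun z : Euc N × Euc N => p z.1 z.2) (m : ℝ) (hm : ∀ x y, m ≤ p x y)
    (hLH : LogHolderType Set.univ p) :
    ∃ p0 δ : ℝ, 0 < δ ∧ δ ≤ 1 ∧ (∀ x, p x x = p0) ∧ ∀ x y, dist x y < δ → p0 ≤ p x y := by
  obtain ⟨ε, hε, C, hC⟩ := hLH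
  have : Nonempty (Fin N) := ⟨⟨0, hN⟩⟩
  have : Nontrivial (Euc N) := inferInstance
  have key : ∀ x z w : Euc N, dist z x < ε / 2 → dist w x < ε / 2 → p x x ≤ p z w := by
    intro x z w hz hw
    by_contra hlt
    push Not at hlt
    have h1 : Tendsto (fun y => p x y - p z w) (𝓝[≠] x) (𝓝 (p x x - p z w)) := by
      have : Continuous fun y => p x y - p z w :=
        (hpc.comp (by fun_prop : Continuous fun y : Euc N => (x, y))).sub continuous_const
      exact (this.tendsto x).mono_left nhdsWithin_le_nhds
    have hd : Tendsto (fun y => dist x y) (𝓝[≠] x) (𝓝[>] 0) := by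
      refine tendsto_nhdsWithin_iff.2 ⟨?_, ?_⟩
      · have : Continuous fun y => dist x y := by fun_prop
        have h := (this.tendsto x).mono_left (nhdsWithin_le_nhds (s := {x}ᶜ))
        simpa using h
      · filter_upwards [self_mem_nhdsWithin] with y hy
        exact dist_pos.2 (fun h => hy h.symm)
    have h2 : Tendsto (fun y => Real.log (1 / dist x y)) (𝓝[≠] x) atTop := by
      have := Real.tendsto_log_atTop.comp (tendsto_inv_nhdsGT_zero.comp hd)
      simpa [Function.comp_def] using this
    have h3 := h1.pos_mul_atTop (sub_pos.2 hlt) h2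
    have e1 := h3.eventually (eventually_gt_atTop C)
    have e2 := (tendsto_nhdsWithin_iff.1 hd).1.eventually
      (gt_mem_nhds (show (0:ℝ) < min (ε/2) (1/2) by positivity))
    have e3 := (tendsto_nhdsWithin_iff.1 hd).2
    obtain ⟨y, h1, h2, h3⟩ := (e1.and (e2.and e3)).exists
    have h3' : 0 < dist x y := h3
    have hy2 : dist x y < 1/2 := lt_of_lt_of_le h2 (min_le_right _ _)
    have hy1 : dist x y < ε/2 := lt_of_lt_of_le h2 (min_le_left _ _)
    have hc := hC x (mem_univ _) y (mem_univ _) h3' hy2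
    have hl : locInf Set.univ p ε x y ≤ p z w := by
      refine csInf_le ⟨m, ?_⟩ ⟨z, ⟨?_, mem_univ _⟩, w, ⟨?_, mem_univ _⟩, rfl⟩
      · rintro _ ⟨a, _, b, _, rfl⟩; exact hm a b
      · rw [Metric.mem_ball]; linarith
      · rw [Metric.mem_ball]; linarith [dist_triangle w x y]
    have hlog : 0 ≤ Real.log (1 / dist x y) := by
      apply Real.log_nonneg
      rw [le_div_iff₀ h3']; linarith
    have : (p x y - p z w) * Real.log (1 / dist x y)
        ≤ |p x y - locInf Set.univ p ε x y| * Real.log (1 / dist x y) := by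
      apply mul_le_mul_of_nonneg_right _ hlog
      exact le_trans (by linarith) (le_abs_self _)
    linarith
  have hloc : IsLocallyConstant fun x => p x x := by
    rw [IsLocallyConstant.iff_eventually_eq]
    intro x
    filter_upwards [Metric.ball_mem_nhds x (show 0 < ε/2 by positivity)] with y hy
    rw [Metric.mem_ball] at hy
    apply le_antisymm
    · exact key y x x (by rwa [dist_comm]) (by rwa [dist_comm])
    · exact key x y y hy hy
  have hconst : ∀ x, p x x = p 0 0 := fun x =>
    hloc.apply_eq_of_isPreconnected isPreconnected_univ (mem_univ x) (mem_univ 0)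
  refine ⟨p 0 0, min (ε/2) 1, by positivity, min_le_right _ _, hconst, fun x y h => ?_⟩
  rw [← hconst x]
  refine key x x y (by simpa using hε) ?_
  rw [dist_comm]; exact lt_of_lt_of_le h (min_le_left _ _)

lemma aux_pt {N : ℕ} (hN : 0 < N) (s : ℝ) (hs : 0 < s) (p : Euc N → Euc N → ℝ)
    (hpc : Continuous fun z : Euc N × Euc N => p z.1 z.2) (p0 δ : ℝ) (hδ : 0 < δ) (hδ1 : δ ≤ 1)
    (hp0 : 0 < p0) (hp : ∀ x y, dist x y < δ → p0 ≤ p x y)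
    (a : ℝ) (ha : 0 < a) (haθ : p0 + a * (s * p0 / N) = a) :
    ∃ κ C : ℝ, 0 < κ ∧ 0 < C ∧ ∀ (v : Euc N → ℝ) (I : ℝ), AEStronglyMeasurable v volume → 0 < I →
      ∫⁻ x, ENNReal.ofReal (|v x| ^ a) ≤ ENNReal.ofReal I →
      ∀ x, 2 ≤ |v x| → κ * I ≤ δ ^ N * |v x| ^ a →
        ENNReal.ofReal (|v x| ^ a) ≤
          ENNReal.ofReal (C * I ^ (s * p0 / N)) * ∫⁻ y, sobKernel s p v x y := by
  set ω := (volume (Metric.ball (0 : Euc N) 1)).toReal with hω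
  have hωt : volume (Metric.ball (0 : Euc N) 1) ≠ ⊤ := measure_ball_lt_top.ne
  have hωpos : 0 < ω := ENNReal.toReal_pos (Metric.measure_ball_pos _ _ one_pos).ne' hωt
  set θ := s * p0 / N with hθ
  have hNr : (0:ℝ) < N := by exact_mod_cast hN
  set κ := 2 ^ (a + 1) / ω with hκ
  have hκpos : 0 < κ := by positivity
  refine ⟨κ, 2 ^ p0 * κ ^ θ / (ω / 2), hκpos, by positivity, ?_⟩
  intro v I hv hI hle x hx2 hx
  set V := |v x| with hV
  have hVpos : 0 < V := by linarith
  have hVa : 0 < V ^ a := by positivity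
  set R := κ * I / V ^ a with hR
  have hRpos : 0 < R := by positivity
  set r := R ^ (1 / (N:ℝ)) with hr
  have hrpos : 0 < r := by positivity
  have hrN : r ^ N = R := by
    rw [hr, ← Real.rpow_natCast, ← Real.rpow_mul hRpos.le]
    field_simp; simp
  have hrδ : r ≤ δ := by
    have : r ^ N ≤ δ ^ N := by
      rw [hrN, hR, div_le_iff₀ hVa]; exact hx
    exact le_of_pow_le_pow_left₀ hN.ne' hδ.le this
  have hr1 : r ≤ 1 := hrδ.trans hδ1
  have hball : volume (Metric.ball x r) = ENNReal.ofReal (ω * R) := by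
    rw [Measure.addHaar_ball_of_pos _ _ hrpos, finrank_euclideanSpace_fin, hrN, mul_comm ω,
      ENNReal.ofReal_mul hRpos.le, hω, ENNReal.ofReal_toReal hωt]
  set A := {y | ENNReal.ofReal ((V / 2) ^ a) ≤ ENNReal.ofReal (|v y| ^ a)} with hA
  have hvm : AEMeasurable v volume := hv.aemeasurable
  have hmA : volume A ≤ ENNReal.ofReal (ω * R / 2) := by
    have h1 : ENNReal.ofReal ((V / 2) ^ a) * volume A ≤ ENNReal.ofReal I := by
      refine le_trans (mul_meas_ge_le_lintegral₀ ?_ _) hle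
      exact ((continuous_abs.measurable.comp_aemeasurable hvm).pow_const a).ennreal_ofReal
    have h2 : ENNReal.ofReal I = ENNReal.ofReal ((V / 2) ^ a) * ENNReal.ofReal (ω * R / 2) := by
      rw [← ENNReal.ofReal_mul (by positivity)]
      congr 1
      rw [hR, hκ, Real.div_rpow hVpos.le (by norm_num), Real.rpow_add (by norm_num)]
      field_simp; simp
    rw [h2] at h1
    refine (ENNReal.mul_le_mul_iff_right ?_ ENNReal.ofReal_ne_top).1 h1
    have : 0 < (V/2)^a := by positivity
    simpa using this
  have hmS : ENNReal.ofReal (ω * R / 2) ≤ volume (Metric.ball x r \ A) := by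
    refine le_trans ?_ le_measure_sdiff
    rw [hball]
    refine le_trans ?_ (tsub_le_tsub_left hmA _)
    rw [← ENNReal.ofReal_sub _ (by positivity)]
    apply ENNReal.ofReal_le_ofReal; linarith
  set c := (V / 2) ^ p0 / r ^ ((N:ℝ) + s * p0) with hc
  have hcpos : 0 < c := by positivity
  have hsub : Metric.ball x r \ A ⊆ {y | ENNReal.ofReal c ≤ sobKernel s p v x y} := by
    rintro y ⟨hy, hyA⟩
    rw [Metric.mem_ball, dist_comm] at hy
    have hyV : |v y| < V / 2 := by
      by_contra h
      push Not at h
      exact hyA (ENNReal.ofReal_le_ofReal (Real.rpow_le_rpow (by positivity) h ha.le))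
    have hD : V / 2 ≤ |v x - v y| := by
      have := abs_sub_abs_le_abs_sub (v x) (v y)
      linarith
    have hne : x ≠ y := by
      rintro rfl
      rw [sub_self, abs_zero] at hD; linarith
    have hd : 0 < dist x y := dist_pos.2 hne
    have hpp := hp x y (hy.trans_le hrδ)
    apply ENNReal.ofReal_le_ofReal
    rw [hc]
    apply div_le_div₀ (by positivity)
    · exact (Real.rpow_le_rpow_of_exponent_le (by linarith) hpp).trans
        (Real.rpow_le_rpow (by positivity) hD (by linarith))
    · positivity
    · exact (Real.rpow_le_rpow_of_exponent_ge hd (by linarith)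
        (by gcongr)).trans (Real.rpow_le_rpow hd.le hy.le (by positivity))
  have hint : ENNReal.ofReal (c * (ω * R / 2)) ≤ ∫⁻ y, sobKernel s p v x y := by
    rw [ENNReal.ofReal_mul hcpos.le]
    refine le_trans (mul_le_mul_right (hmS.trans (measure_mono hsub)) _)
      (mul_meas_ge_le_lintegral₀ ?_ _)
    have hpx : Measurable fun y => p x y :=
      (hpc.comp (by fun_prop : Continuous fun y : Euc N => (x, y))).measurable
    have h1 : AEMeasurable (fun y => |v x - v y|) volume :=
      continuous_abs.measurable.comp_aemeasurable (hvm.const_sub _)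
    have h2 : Measurable (fun y => dist x y ^ ((N : ℝ) + s * p x y)) :=
      (by fun_prop : Measurable fun y : Euc N => dist x y).pow ((hpx.const_mul s).const_add _)
    exact ((h1.pow hpx.aemeasurable).div h2.aemeasurable).ennreal_ofReal
  refine le_trans ?_ (mul_le_mul_right hint _)
  rw [← ENNReal.ofReal_mul (by positivity)]
  apply ENNReal.ofReal_le_ofReal
  apply le_of_eq
  have hrr : r ^ ((N:ℝ) + s * p0) = R * (κ ^ θ * I ^ θ / V ^ (a * θ)) := by
    rw [Real.rpow_add hrpos, Real.rpow_natCast, hrN]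
    congr 1
    rw [Real.rpow_mul hVpos.le, ← Real.mul_rpow hκpos.le hI.le, ← Real.div_rpow (by positivity) hVa.le,
      ← hR, hr, ← Real.rpow_mul hRpos.le]
    congr 1
    rw [hθ]; ring
  have hVV : V ^ a = V ^ p0 * V ^ (a * θ) := by
    rw [← Real.rpow_add hVpos, haθ]
  rw [hc, hrr, Real.div_rpow hVpos.le (by norm_num), hVV]
  have : 0 < V ^ (a*θ) := by positivity
  have : 0 < κ ^ θ := by positivity
  have : 0 < I ^ θ := by positivity
  have : (0:ℝ) < 2 ^ p0 := by positivity
  field_simp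

lemma aux_bdd {N : ℕ} (hN : 0 < N) (s : ℝ) (hs : 0 < s) (p : Euc N → Euc N → ℝ)
    (hpc : Continuous fun z : Euc N × Euc N => p z.1 z.2) (p0 δ : ℝ) (hδ : 0 < δ) (hδ1 : δ ≤ 1)
    (hp0 : 0 < p0) (hp : ∀ x y, dist x y < δ → p0 ≤ p x y)
    (a : ℝ) (ha : 0 < a) (haθ : p0 + a * (s * p0 / N) = a) (hθ1 : s * p0 / N < 1) :
    ∃ K : ℝ, ∀ (v : Euc N → ℝ) (M : ℝ), AEStronglyMeasurable v volume → (∀ x, |v x| ≤ M) →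
      ∫⁻ x, ENNReal.ofReal (|v x| ^ p0) ≤ 1 → ∫⁻ x, ∫⁻ y, sobKernel s p v x y ≤ 1 →
      ∫⁻ x, ENNReal.ofReal (|v x| ^ a) ≤ ENNReal.ofReal K := by
  obtain ⟨κ, C, hκ, hC, H⟩ := aux_pt hN s hs p hpc p0 δ hδ hδ1 hp0 hp a ha haθ
  have hNr : (0:ℝ) < N := by exact_mod_cast hN
  set θ := s * p0 / N with hθ
  have hθ0 : 0 < θ := by positivity
  have hap : a - p0 = a * θ := by linarith
  have hap0 : 0 < a - p0 := by rw [hap]; positivity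
  set κ' := κ / δ ^ N with hκ'
  have hκ'0 : 0 < κ' := by positivity
  set B := C + 2 ^ (a - p0) + κ' ^ θ with hB
  have hB0 : 0 < B := by positivity
  refine ⟨max 1 (B ^ (1 / (1 - θ))), ?_⟩
  intro v M hv hM h1 h2
  have hvm : AEMeasurable v volume := hv.aemeasurable
  have hm : ∀ e : ℝ, AEMeasurable (fun x => ENNReal.ofReal (|v x| ^ e)) volume := fun e =>
    ((continuous_abs.measurable.comp_aemeasurable hvm).pow_const e).ennreal_ofReal
  have split : ∀ x, |v x| ^ a = |v x| ^ (a - p0) * |v x| ^ p0 := by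
    intro x
    rw [← Real.rpow_add_of_nonneg (abs_nonneg _) hap0.le hp0.le]; congr 1; ring
  have hfin : ∫⁻ x, ENNReal.ofReal (|v x| ^ a) ≠ ⊤ := by
    refine ne_top_of_le_ne_top (b := ENNReal.ofReal (M ^ (a - p0)) * 1)
      (by finiteness) ?_
    refine le_trans ?_ (mul_le_mul_right h1 _)
    rw [← lintegral_const_mul' _ _ ENNReal.ofReal_ne_top]
    apply lintegral_mono
    intro x
    dsimp only
    have hM0 : 0 ≤ M := (abs_nonneg _).trans (hM x)
    rw [← ENNReal.ofReal_mul (by positivity), split x]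
    apply ENNReal.ofReal_le_ofReal
    gcongr
    exact hM x
  set J := ∫⁻ x, ENNReal.ofReal (|v x| ^ a) with hJ
  set I := J.toReal with hI
  have hJI : J = ENNReal.ofReal I := (ENNReal.ofReal_toReal hfin).symm
  rw [hJI]
  apply ENNReal.ofReal_le_ofReal
  rcases le_total I 1 with hI1 | hI1
  · exact hI1.trans (le_max_left _ _)
  have hI0 : 0 < I := by linarith
  have hmain : J ≤ ENNReal.ofReal (C * I ^ θ) * 1
      + ENNReal.ofReal (2 ^ (a - p0) + (κ' * I) ^ θ) * 1 := by
    refine le_trans ?_ (add_le_add (mul_le_mul_right h2 _) (mul_le_mul_right h1 _))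
    rw [← lintegral_const_mul' _ _ ENNReal.ofReal_ne_top,
      ← lintegral_const_mul' _ _ ENNReal.ofReal_ne_top,
      ← lintegral_add_right' _ ((hm p0).const_mul _)]
    apply lintegral_mono
    intro x
    dsimp only
    by_cases hx : 2 ≤ |v x| ∧ κ * I ≤ δ ^ N * |v x| ^ a
    · exact (H v I hv hI0 hJI.le x hx.1 hx.2).trans le_self_add
    · refine le_trans ?_ le_add_self
      rw [← ENNReal.ofReal_mul (by positivity), split x]
      apply ENNReal.ofReal_le_ofReal
      gcongr
      by_cases hx2 : 2 ≤ |v x|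
      · have hx3 : δ ^ N * |v x| ^ a < κ * I := by
          by_contra h; push Not at h; exact hx ⟨hx2, h⟩
        have : |v x| ^ (a - p0) ≤ (κ' * I) ^ θ := by
          rw [hap, Real.rpow_mul (abs_nonneg _)]
          apply Real.rpow_le_rpow (by positivity) _ hθ0.le
          rw [hκ', div_mul_eq_mul_div, le_div_iff₀ (by positivity)]
          linarith
        have : (0:ℝ) < 2 ^ (a - p0) := by positivity
        linarith
      · push Not at hx2
        have := Real.rpow_le_rpow (abs_nonneg (v x)) hx2.le hap0.le
        have : 0 < (κ' * I) ^ θ := by positivity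
        linarith
  rw [mul_one, mul_one, ← ENNReal.ofReal_add (by positivity) (by positivity), hJI,
    ENNReal.ofReal_le_ofReal_iff (by positivity), Real.mul_rpow hκ'0.le hI0.le] at hmain
  have hIθ : 1 ≤ I ^ θ := Real.one_le_rpow hI1 hθ0.le
  have hle : I ≤ B * I ^ θ := by
    have : (0:ℝ) < 2 ^ (a - p0) := by positivity
    rw [hB]; nlinarith
  have hle2 : I ^ (1 - θ) ≤ B := by
    rw [Real.rpow_sub hI0, Real.rpow_one, div_le_iff₀ (by positivity)]; exact hle
  refine le_trans ?_ (le_max_right _ _)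
  have h1θ : 0 < 1 - θ := by linarith
  have := Real.rpow_le_rpow (by positivity) hle2 (show 0 ≤ 1 / (1 - θ) by positivity)
  rwa [← Real.rpow_mul hI0.le, mul_one_div_cancel h1θ.ne', Real.rpow_one] at this

lemma aux_all {N : ℕ} (hN : 0 < N) (s : ℝ) (hs : 0 < s) (p : Euc N → Euc N → ℝ)
    (hpc : Continuous fun z : Euc N × Euc N => p z.1 z.2) (p0 δ : ℝ) (hδ : 0 < δ) (hδ1 : δ ≤ 1)
    (hp0 : 0 < p0) (hpp : ∀ x y, 0 ≤ p x y) (hp : ∀ x y, dist x y < δ → p0 ≤ p x y)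
    (a : ℝ) (ha : 0 < a) (haθ : p0 + a * (s * p0 / N) = a) (hθ1 : s * p0 / N < 1) :
    ∃ K : ℝ, ∀ (v : Euc N → ℝ), AEStronglyMeasurable v volume →
      ∫⁻ x, ENNReal.ofReal (|v x| ^ p0) ≤ 1 → ∫⁻ x, ∫⁻ y, sobKernel s p v x y ≤ 1 →
      ∫⁻ x, ENNReal.ofReal (|v x| ^ a) ≤ ENNReal.ofReal K := by
  obtain ⟨K, H⟩ := aux_bdd hN s hs p hpc p0 δ hδ hδ1 hp0 hp a ha haθ hθ1
  refine ⟨K, fun v hv h1 h2 => ?_⟩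
  have hvm : AEMeasurable v volume := hv.aemeasurable
  set w : ℕ → Euc N → ℝ := fun n x => max (-(n:ℝ)) (min n (v x)) with hw
  have habs : ∀ n x, |w n x| = min (n:ℝ) |v x| := by
    intro n x
    have hn : (0:ℝ) ≤ n := n.cast_nonneg
    simp only [hw]
    rcases le_total 0 (v x) with h | h
    · rw [abs_of_nonneg h, max_eq_right (by have := le_min hn h; linarith), abs_of_nonneg (le_min hn h)]
    · rw [abs_of_nonpos h, min_eq_right (by linarith), abs_of_nonpos (by simp [h, hn]),
        ← min_neg_neg, neg_neg]
  have hwm : ∀ n, AEMeasurable (w n) volume := fun n =>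
    aemeasurable_const.max (aemeasurable_const.min hvm)
  have hmeas : ∀ n, AEMeasurable (fun x => ENNReal.ofReal (|w n x| ^ a)) volume := fun n =>
    ((continuous_abs.measurable.comp_aemeasurable (hwm n)).pow_const a).ennreal_ofReal
  have hlim := lintegral_tendsto_of_tendsto_of_monotone (μ := volume)
    (f := fun n x => ENNReal.ofReal (|w n x| ^ a)) (F := fun x => ENNReal.ofReal (|v x| ^ a))
    hmeas (ae_of_all _ fun x n m hnm => by
      apply ENNReal.ofReal_le_ofReal
      apply Real.rpow_le_rpow (abs_nonneg _) _ ha.le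
      rw [habs, habs]
      have : (n:ℝ) ≤ m := by exact_mod_cast hnm
      gcongr) (ae_of_all _ fun x => by
      apply tendsto_const_nhds.congr'
      filter_upwards [eventually_ge_atTop ⌈|v x|⌉₊] with n hn
      have : |v x| ≤ n := (Nat.le_ceil _).trans (by exact_mod_cast hn)
      rw [habs, min_eq_right this])
  refine le_of_tendsto' hlim fun n => H (w n) n (hwm n).aestronglyMeasurable
    (fun x => by rw [habs]; exact min_le_left _ _) (le_trans (lintegral_mono fun x => ?_) h1)
    (le_trans (lintegral_mono fun x => lintegral_mono fun y => ?_) h2)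
  · apply ENNReal.ofReal_le_ofReal
    apply Real.rpow_le_rpow (abs_nonneg _) _ hp0.le
    rw [habs]; exact min_le_right _ _
  · apply ENNReal.ofReal_le_ofReal
    apply div_le_div_of_nonneg_right _ (by positivity)
    apply Real.rpow_le_rpow (abs_nonneg _) _ (hpp x y)
    simp only [hw]
    refine (abs_max_sub_max_le_max _ _ _ _).trans ?_
    rw [sub_self, abs_zero, max_eq_right (abs_nonneg _)]
    refine (abs_min_sub_min_le_max _ _ _ _).trans ?_
    rw [sub_self, abs_zero, max_eq_right (abs_nonneg _)]

/-- scaling for the variable modular -/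
lemma aux_scale_s1 {N : ℕ} (q : Euc N → ℝ) (Q : ℝ) (hq0 : ∀ x, 0 ≤ q x) (hqQ : ∀ x, q x ≤ Q)
    (u : Euc N → ℝ) (c : ℝ) (hc : 0 < c) :
    varModular volume q u ≤
      ENNReal.ofReal ((max 1 c) ^ Q) * varModular volume q (fun x => u x / c) := by
  unfold varModular
  rw [← lintegral_const_mul' _ _ ENNReal.ofReal_ne_top]
  apply lintegral_mono
  intro x
  dsimp only
  rw [← ENNReal.ofReal_mul (by positivity)]
  apply ENNReal.ofReal_le_ofReal
  have h : |u x| = c * |u x / c| := by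
    rw [abs_div, abs_of_pos hc]; field_simp
  rw [h, Real.mul_rpow hc.le (abs_nonneg _)]
  apply mul_le_mul_of_nonneg_right _ (by positivity)
  exact (Real.rpow_le_rpow hc.le (le_max_right 1 c) (hq0 x)).trans
    (Real.rpow_le_rpow_of_exponent_le (le_max_left _ _) (hqQ x))

lemma aux_shrink (t e K : ℝ) (hK : 1 ≤ K) (he : 1 ≤ e) : |t / K| ^ e ≤ (1 / K) * |t| ^ e := by
  have hK0 : 0 < K := by linarith
  rw [abs_div, abs_of_pos hK0, Real.div_rpow (abs_nonneg _) hK0.le, div_eq_mul_one_div, mul_comm]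
  apply mul_le_mul_of_nonneg_right _ (by positivity)
  apply one_div_le_one_div_of_le hK0
  simpa using Real.rpow_le_rpow_of_exponent_le hK he

lemma aux_sob {N : ℕ} (s : ℝ) (p : Euc N → Euc N → ℝ) (hp1 : ∀ x y, 1 ≤ p x y)
    (u : Euc N → ℝ) (hu : sobModular Set.univ s p u < ⊤) :
    ∃ c : ℝ, 0 < c ∧ sobModular Set.univ s p (fun x => u x / c) ≤ 1 := by
  set S := sobModular Set.univ s p u with hS
  set c := max 1 S.toReal with hc
  have hc1 : 1 ≤ c := le_max_left _ _
  have hc0 : 0 < c := by linarith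
  refine ⟨c, hc0, ?_⟩
  have : sobModular Set.univ s p (fun x => u x / c) ≤ ENNReal.ofReal (1 / c) * S := by
    rw [hS]
    unfold sobModular
    rw [mul_add]
    apply add_le_add
    · rw [← lintegral_const_mul' _ _ ENNReal.ofReal_ne_top]
      apply lintegral_mono
      intro x
      dsimp only
      rw [← ENNReal.ofReal_mul (by positivity)]
      exact ENNReal.ofReal_le_ofReal (aux_shrink _ _ _ hc1 (hp1 x x))
    · rw [← lintegral_const_mul' _ _ ENNReal.ofReal_ne_top]
      apply lintegral_mono
      intro x
      dsimp only
      rw [← lintegral_const_mul' _ _ ENNReal.ofReal_ne_top]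
      apply lintegral_mono
      intro y
      simp only [sobKernel]
      rw [← ENNReal.ofReal_mul (by positivity)]
      apply ENNReal.ofReal_le_ofReal
      rw [← sub_div, ← mul_div_assoc]
      exact div_le_div_of_nonneg_right (aux_shrink _ _ _ hc1 (hp1 x y)) (by positivity)
  refine this.trans ?_
  rw [← ENNReal.ofReal_toReal hu.ne, ← ENNReal.ofReal_mul (by positivity), ← ENNReal.ofReal_one]
  apply ENNReal.ofReal_le_ofReal
  rw [one_div_mul_eq_div, div_le_one hc0]
  exact le_max_right _ _

/-- Theorem 3.4, whole space case: critical Sobolev-type imbedding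
`W^{s,p(·,·)}(ℝ^N) ↪ L^{q(·)}(ℝ^N)`. -/
theorem critical_imbedding_Rn {N : ℕ}
    (s : ℝ) (hs : s ∈ Set.Ioo (0 : ℝ) 1)
    (p : Euc N → Euc N → ℝ)
    (hpuc : UniformContinuous fun z : Euc N × Euc N => p z.1 z.2)
    (hpsym : ∀ x y, p x y = p y x)
    (pminus pplus : ℝ)
    (hpminus : IsGLB (Set.range fun z : Euc N × Euc N => p z.1 z.2) pminus)
    (hpplus : IsLUB (Set.range fun z : Euc N × Euc N => p z.1 z.2) pplus)
    (hpm1 : 1 < pminus) (hppN : pplus < (N : ℝ) / s)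
    (hLH : LogHolderType Set.univ p)
    (q : Euc N → ℝ) (hquc : UniformContinuous q)
    (qminus qplus : ℝ)
    (hqm : ∀ x, qminus ≤ q x) (hqp : ∀ x, q x ≤ qplus) (hqm1 : 1 < qminus)
    (hpq : ∀ x, p x x < q x)
    (hq : ∀ x : Euc N, ∃ ε > (0 : ℝ), ∀ y ∈ Metric.ball x ε,
      q y ≤ (N : ℝ) * locInf Set.univ p ε x x / ((N : ℝ) - s * locInf Set.univ p ε x x)) :
    ∃ C > (0 : ℝ), ∀ u : Euc N → ℝ, MemSob Set.univ s p u →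
      MemVarLp volume q u ∧
      luxNorm volume q u ≤ C * sobNorm Set.univ s p u := by
  obtain ⟨hs0, hs1⟩ := hs
  have hpm : ∀ x y, pminus ≤ p x y := fun x y => hpminus.1 ⟨(x, y), rfl⟩
  have hpM : ∀ x y, p x y ≤ pplus := fun x y => hpplus.1 ⟨(x, y), rfl⟩
  have hN : 0 < N := by
    rcases Nat.eq_zero_or_pos N with h | h
    · subst h
      have := hpm 0 0
      have := hpM 0 0
      simp at hppN
      linarith
    · exact h
  have hNr : (0:ℝ) < N := by exact_mod_cast hN
  obtain ⟨p0, δ, hδ, hδ1, hdiag, hnear⟩ := aux_diag hN p hpuc.continuous pminus hpm hLH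
  have hp01 : 1 < p0 := by rw [← hdiag 0]; exact hpm1.trans_le (hpm _ _)
  have hsp : s * p0 < N := by
    have : p0 < N / s := by rw [← hdiag 0]; exact (hpM _ _).trans_lt hppN
    rw [lt_div_iff₀ hs0] at this; linarith
  have hNs : 0 < N - s * p0 := by linarith
  set a := N * p0 / (N - s * p0) with ha
  have ha0 : 0 < a := by positivity
  have haθ : p0 + a * (s * p0 / N) = a := by
    have e : a * (N - s * p0) = N * p0 := div_mul_cancel₀ _ hNs.ne'
    clear_value a
    field_simp
    linarith
  obtain ⟨K, HK⟩ := aux_all hN s hs0 p hpuc.continuous p0 δ hδ hδ1 (by linarith)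
    (fun x y => by linarith [hpm x y]) hnear a ha0
    haθ (by rw [div_lt_one hNr]; exact hsp)
  have hqa : ∀ x, q x ≤ a := by
    intro x
    obtain ⟨ε, hε, h⟩ := hq x
    refine (h x (Metric.mem_ball_self hε)).trans ?_
    set L := locInf Set.univ p ε x x with hL
    have hLp : L ≤ p0 := by
      rw [← hdiag x]
      refine csInf_le ⟨pminus, ?_⟩ ⟨x, ⟨Metric.mem_ball_self hε, mem_univ _⟩, x,
        ⟨Metric.mem_ball_self hε, mem_univ _⟩, rfl⟩
      rintro _ ⟨a, _, b, _, rfl⟩; exact hpm a b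
    have : s * L ≤ s * p0 := by gcongr
    rw [ha]
    apply div_le_div₀ (by positivity) (by gcongr) hNs (by linarith)
  set K1 := 1 + max 0 K with hK1
  have hK11 : 1 ≤ K1 := by rw [hK1]; linarith [le_max_left 0 K]
  have hK10 : 0 < K1 := by linarith
  have step : ∀ u : Euc N → ℝ, AEStronglyMeasurable u volume → ∀ c : ℝ, 0 < c →
      sobModular Set.univ s p (fun x => u x / c) ≤ 1 →
      varModular volume q (fun x => u x / (K1 * c)) ≤ 1 := by
    intro u hu c hc hm
    set v := fun x => u x / c with hv
    have hvm : AEStronglyMeasurable v volume :=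
      (hu.aemeasurable.div_const c).aestronglyMeasurable
    unfold sobModular at hm
    simp only [Measure.restrict_univ, hdiag] at hm
    have h1 := le_self_add.trans hm
    have h2 := le_add_self.trans hm
    have h3 := HK v hvm h1 h2
    have h4 : varModular volume q v ≤ ENNReal.ofReal K1 := by
      unfold varModular
      calc ∫⁻ x, ENNReal.ofReal (|v x| ^ q x)
          ≤ ∫⁻ x, (ENNReal.ofReal (|v x| ^ p0) + ENNReal.ofReal (|v x| ^ a)) := by
            apply lintegral_mono
            intro x
            dsimp only
            rcases le_total 1 |v x| with h | h
            · exact (ENNReal.ofReal_le_ofReal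
                (Real.rpow_le_rpow_of_exponent_le h (hqa x))).trans le_add_self
            · refine (ENNReal.ofReal_le_ofReal ?_).trans le_self_add
              have hpq' : p0 ≤ q x := by rw [← hdiag x]; exact (hpq x).le
              exact Real.rpow_le_rpow_of_exponent_ge' (abs_nonneg _) h (by linarith) hpq'
        _ = (∫⁻ x, ENNReal.ofReal (|v x| ^ p0)) + ∫⁻ x, ENNReal.ofReal (|v x| ^ a) := by
            apply lintegral_add_left'
            exact ((continuous_abs.measurable.comp_aemeasurable
              hvm.aemeasurable).pow_const p0).ennreal_ofReal
        _ ≤ 1 + ENNReal.ofReal (max 0 K) :=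
            add_le_add h1 (h3.trans (ENNReal.ofReal_le_ofReal (le_max_right _ _)))
        _ = ENNReal.ofReal K1 := by
            rw [hK1, ENNReal.ofReal_add zero_le_one (le_max_left _ _), ENNReal.ofReal_one]
    calc varModular volume q (fun x => u x / (K1 * c))
        ≤ ENNReal.ofReal (1 / K1) * varModular volume q v := by
          unfold varModular
          rw [← lintegral_const_mul' _ _ ENNReal.ofReal_ne_top]
          apply lintegral_mono
          intro x
          dsimp only
          rw [← ENNReal.ofReal_mul (by positivity)]
          apply ENNReal.ofReal_le_ofReal
          have : u x / (K1 * c) = v x / K1 := by rw [hv]; field_simp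
          rw [this]
          exact aux_shrink _ _ _ hK11 (hqm1.le.trans (hqm x))
      _ ≤ ENNReal.ofReal (1 / K1) * ENNReal.ofReal K1 := by gcongr
      _ = 1 := by
          rw [← ENNReal.ofReal_mul (by positivity), one_div_mul_cancel hK10.ne', ENNReal.ofReal_one]
  refine ⟨K1, hK10, ?_⟩
  rintro u ⟨hum, hus⟩
  rw [Measure.restrict_univ] at hum
  obtain ⟨c0, hc0, hc0'⟩ := aux_sob s p (fun x y => hpm1.le.trans (hpm x y)) u hus
  refine ⟨⟨hum, ?_⟩, ?_⟩
  · refine (aux_scale_s1 q qplus (fun x => by linarith [hqm x]) hqp u (K1 * c0)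
      (by positivity)).trans_lt ?_
    exact ENNReal.mul_lt_top ENNReal.ofReal_lt_top
      ((step u hum c0 hc0 hc0').trans_lt ENNReal.one_lt_top)
  · rw [← div_le_iff₀' hK10]
    refine le_csInf (s := {c : ℝ | 0 < c ∧ sobModular Set.univ s p (fun x => u x / c) ≤ 1})
      ⟨c0, hc0, hc0'⟩ ?_
    rintro c ⟨hc, hc'⟩
    rw [div_le_iff₀' hK10]
    exact csInf_le ⟨0, fun y hy => hy.1.le⟩ ⟨by positivity, step u hum c hc hc'⟩
end
end

section
/- Let s ∈ (0,1) and p: ℝ^N×ℝ^N → ℝ be uniformly continuous and symmetric with 1 < inf p ≤ sup p < N/s, satisfying the log-Hölder type continuity condition: inf_{ε>0} sup{ |p(x,y) − inf_{B_ε(x)×B_ε(y)} p| · log(1/|x−y|) : x,y ∈ ℝ^N, 0 < |x−y| < 1/2 } < ∞. Let q: ℝ^N → ℝ be uniformly continuous with 1 < inf q ≤ sup q < ∞ and p(x,x) < q(x) for all x, and such that for every x ∈ ℝ^N there exists ε > 0 with sup_{y∈B_ε(x)} q(y) ≤ N·p_ε/(N − s·p_ε), where p_ε := inf_{(y,z)∈B_ε(x)×B_ε(x)}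 p(y,z). Let r: ℝ^N → ℝ be continuous with 1 < inf r ≤ sup r < ∞ and inf_{x∈ℝ^N}(q(x) − r(x)) > 0, and let w be a measurable function, positive a.e., with w ∈ L^{q(·)/(q(·)−r(·))}(ℝ^N). Then W^{s,p(·,·)}(ℝ^N) embeds compactly into L^{r(·)}(w,ℝ^N): the inclusion is continuous and every bounded sequence in W^{s,p(·,·)}(ℝ^N) has a subsequence converging in L^{r(·)}(w,ℝ^N). -/
open MeasureTheory Filter Topology Set
open scoped ENNReal NNReal

noncomputable section

lemma exps {N : ℕ} (hN : 0 < N)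
    (p : Euc N → Euc N → ℝ)
    (hpc : Continuous fun z : Euc N × Euc N => p z.1 z.2)
    (pminus : ℝ) (hpm : ∀ x y, pminus ≤ p x y)
    (hLH : LogHolderType Set.univ p) :
    ∃ δ > 0, δ < 1 ∧ (∀ x y, p x x = p y y) ∧ ∀ x y, dist x y < δ → p x x ≤ p x y := by
  obtain ⟨ε, hε, C, hC⟩ := hLH
  have : Nonempty (Fin N) := ⟨⟨0, hN⟩⟩
  have key : ∀ x a b : Euc N, dist a x < ε → dist b x < ε → p x x ≤ p a b := by
    intro x a b ha hb
    have hne : (𝓝[≠] x).NeBot := inferInstance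
    have h1 : Tendsto (fun y => p x y - p a b) (𝓝[≠] x) (𝓝 (p x x - p a b)) := by
      have : Continuous fun y => p x y - p a b :=
        (hpc.comp (Continuous.prodMk continuous_const continuous_id)).sub continuous_const
      exact (this.tendsto x).mono_left nhdsWithin_le_nhds
    have hd : Tendsto (fun y => dist x y) (𝓝[≠] x) (𝓝[>] 0) := by
      rw [tendsto_nhdsWithin_iff]
      constructor
      · have : Continuous fun y => dist x y := by fun_prop
        simpa using (this.tendsto x).mono_left nhdsWithin_le_nhds
      · filter_upwards [self_mem_nhdsWithin] with y hy
        exact dist_pos.2 (Ne.symm hy)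
    have h2 : Tendsto (fun y => C / Real.log (1 / dist x y)) (𝓝[≠] x) (𝓝 0) := by
      have : Tendsto (fun t : ℝ => Real.log (1 / t)) (𝓝[>] 0) atTop := by
        simp only [one_div]
        exact Real.tendsto_log_atTop.comp tendsto_inv_nhdsGT_zero
      exact (this.comp hd).const_div_atTop C
    have h3 : ∀ᶠ y in 𝓝[≠] x, p x y - p a b ≤ C / Real.log (1 / dist x y) := by
      have e1 : ∀ᶠ y in 𝓝[≠] x, dist b y < ε := by
        have : Continuous fun y => dist b y := by fun_prop
        exact nhdsWithin_le_nhds ((this.tendsto x).eventually (gt_mem_nhds hb))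
      have e2 : ∀ᶠ y in 𝓝[≠] x, dist x y < 1/2 := by
        have : Continuous fun y => dist x y := by fun_prop
        exact nhdsWithin_le_nhds ((this.tendsto x).eventually (gt_mem_nhds (by simp)))
      filter_upwards [e1, e2, self_mem_nhdsWithin] with y h1 h2 hy
      have hpos : 0 < dist x y := dist_pos.2 (Ne.symm hy)
      have := hC x trivial y trivial hpos h2
      have hlog : 0 < Real.log (1 / dist x y) := by
        apply Real.log_pos
        rw [lt_div_iff₀ hpos]; linarith
      rw [le_div_iff₀ hlog]
      refine le_trans (mul_le_mul_of_nonneg_right ?_ hlog.le) this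
      refine le_trans ?_ (le_abs_self _)
      have : locInf Set.univ p ε x y ≤ p a b := by
        apply csInf_le
        · refine ⟨pminus, ?_⟩
          rintro _ ⟨c, _, d, _, rfl⟩
          exact hpm c d
        · exact ⟨a, ⟨ha, trivial⟩, b, ⟨h1, trivial⟩, rfl⟩
      linarith
    have := le_of_tendsto_of_tendsto h1 h2 h3
    linarith
  refine ⟨min ε (1/2), by positivity, lt_of_le_of_lt (min_le_right _ _) (by norm_num), ?_, ?_⟩
  · have : IsLocallyConstant (fun x => p x x) := by
      rw [IsLocallyConstant.iff_eventually_eq]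
      intro x
      filter_upwards [Metric.ball_mem_nhds x hε] with y hy
      have hy' : dist y x < ε := hy
      exact le_antisymm (key y x x (by rwa [dist_comm]) (by rwa [dist_comm])) (key x y y hy' hy')
    intro x y
    exact this.apply_eq_of_preconnectedSpace x y
  · intro x y h
    refine key x x y (by simpa using hε) ?_
    rw [dist_comm]; exact lt_of_lt_of_le h (min_le_left _ _)

/-- Pointwise estimate. -/
lemma sob_point {N : ℕ} (hN : 0 < N) {s : ℝ} (hs : 0 < s) (p : Euc N → Euc N → ℝ)
    (p0 δ : ℝ) (hp0 : 1 < p0) (hsp : s * p0 < N) (hδ : 0 < δ) (hδ1 : δ < 1)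
    (hnear : ∀ x y, dist x y < δ → p0 ≤ p x y) (ps θ : ℝ)
    (hps : ps = N * p0 / (N - s * p0)) (hθ : θ = s * p0 / N) :
    ∃ C > (0:ℝ), ∀ u : Euc N → ℝ, Measurable u → ∀ T : ℝ, 0 < T → ∀ I : ℝ, 0 < I →
      ∫⁻ y, ENNReal.ofReal ((min |u y| T) ^ ps) = ENNReal.ofReal I →
      ∀ x, 2 ≤ min |u x| T →
      ENNReal.ofReal ((min |u x| T) ^ ps) ≤ ENNReal.ofReal (C * I ^ θ) *
        (ENNReal.ofReal (|u x| ^ p0) + ∫⁻ y, sobKernel s p u x y) := by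
  have : Nonempty (Fin N) := ⟨⟨0, hN⟩⟩
  have hNr : (0:ℝ) < N := by exact_mod_cast hN
  set ω : ℝ := (volume (Metric.ball (0 : Euc N) 1)).toReal with hω
  have hωe : volume (Metric.ball (0 : Euc N) 1) = ENNReal.ofReal ω := by
    rw [hω, ENNReal.ofReal_toReal]; exact measure_ball_lt_top.ne
  have hωpos : 0 < ω := ENNReal.toReal_pos (Metric.measure_ball_pos _ _ one_pos).ne'
    measure_ball_lt_top.ne
  have hpspos : 0 < ps := by rw [hps]; apply div_pos (by positivity); linarith
  have hθpos : 0 < θ := by rw [hθ]; positivity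
  have hrel : p0 + ps * θ = ps := by
    have h0 : 0 < (N:ℝ) - s * p0 := by linarith
    have h1 : θ * N = s * p0 := by rw [hθ]; field_simp
    have h2 : ps * (N - s * p0) = N * p0 := by rw [hps]; exact div_mul_cancel₀ _ h0.ne'
    rw [← h1] at h2
    have h3 : (N:ℝ) * (p0 + ps * θ) = N * ps := by linarith
    exact mul_left_cancel₀ hNr.ne' h3
  set A : ℝ := 2 * 2 ^ ps / ω with hA
  have hApos : 0 < A := by positivity
  refine ⟨2 ^ p0 * (2 / ω) * A ^ θ + (A / δ ^ N) ^ θ, by positivity, ?_⟩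
  intro u hu T hT I hI hint x hx
  set v : Euc N → ℝ := fun y => min |u y| T with hv
  have hvm : Measurable v := by fun_prop
  set τ := v x with hτ
  have hτ2 : 2 ≤ τ := hx
  change ENNReal.ofReal (τ ^ ps) ≤ _
  have hτpos : 0 < τ := by linarith
  have hτu : τ ≤ |u x| := min_le_left _ _
  set r : ℝ := (A * I / τ ^ ps) ^ (1 / (N:ℝ)) with hr
  have hbase : 0 < A * I / τ ^ ps := by positivity
  have hrpos : 0 < r := by positivity
  have hrN : r ^ N = A * I / τ ^ ps := by
    rw [hr, ← Real.rpow_natCast, ← Real.rpow_mul hbase.le]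
    rw [one_div_mul_cancel hNr.ne', Real.rpow_one]
  have hsplit : τ ^ ps = τ ^ p0 * (τ ^ ps) ^ θ := by
    rw [← Real.rpow_mul hτpos.le, ← Real.rpow_add hτpos, hrel]
  by_cases hrδ : r < δ
  · -- main case
    have hrs : r ^ (s * p0) = (A * I) ^ θ / (τ ^ ps) ^ θ := by
      rw [← Real.div_rpow (by positivity) (by positivity), ← hrN, ← Real.rpow_natCast,
        ← Real.rpow_mul hrpos.le, hθ]
      congr 1; field_simp
    have hball : volume (Metric.ball x r) = ENNReal.ofReal (r ^ N * ω) := by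
      rw [Measure.addHaar_ball_of_pos _ _ hrpos, hωe, ← ENNReal.ofReal_mul (by positivity)]
      simp
    set S := {y | τ / 2 ≤ v y} with hS
    have hSm : MeasurableSet S := measurableSet_le measurable_const hvm
    have hSvol : volume S ≤ ENNReal.ofReal (r ^ N * ω / 2) := by
      have h1 : ENNReal.ofReal ((τ/2) ^ ps) * volume S ≤ ENNReal.ofReal I := by
        rw [← hint]
        refine le_trans ?_ (mul_meas_ge_le_lintegral (by fun_prop) (ENNReal.ofReal ((τ/2) ^ ps)))
        gcongr
        intro y hy
        simp only [mem_ofPred_eq]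
        apply ENNReal.ofReal_le_ofReal
        exact Real.rpow_le_rpow (by positivity) hy hpspos.le
      have h2 : r ^ N * ω / 2 = I / (τ/2) ^ ps := by
        rw [hrN, hA, Real.div_rpow hτpos.le (by norm_num)]; field_simp
      rw [h2, ENNReal.ofReal_div_of_pos (by positivity)]
      rw [ENNReal.le_div_iff_mul_le (Or.inl (by simp; positivity)) (Or.inl (by simp)), mul_comm]
      exact h1
    have hgood : ENNReal.ofReal (r ^ N * ω / 2) ≤ volume (Metric.ball x r \ S) := by
      have h1 : volume (Metric.ball x r) - volume S ≤ volume (Metric.ball x r \ S) :=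
        le_measure_sdiff
      refine le_trans ?_ h1
      rw [hball]
      refine le_trans ?_ (tsub_le_tsub_left hSvol _)
      rw [← ENNReal.ofReal_sub _ (by positivity)]
      apply ENNReal.ofReal_le_ofReal; linarith
    have hD : ENNReal.ofReal ((τ/2) ^ p0 / r ^ ((N:ℝ) + s * p0)) * ENNReal.ofReal (r ^ N * ω / 2)
        ≤ ∫⁻ y, sobKernel s p u x y := by
      calc _ ≤ ENNReal.ofReal ((τ/2) ^ p0 / r ^ ((N:ℝ) + s * p0)) * volume (Metric.ball x r \ S) := by
            gcongr
        _ = ∫⁻ y in Metric.ball x r \ S, ENNReal.ofReal ((τ/2) ^ p0 / r ^ ((N:ℝ) + s * p0)) := by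
            rw [setLIntegral_const]
        _ ≤ ∫⁻ y in Metric.ball x r \ S, sobKernel s p u x y := by
            apply setLIntegral_mono' (measurableSet_ball.diff hSm)
            intro y hy
            obtain ⟨hyb, hyS⟩ := hy
            have hyb' : dist x y < r := by rw [dist_comm]; exact hyb
            have hvy : v y < τ / 2 := not_le.1 hyS
            have hpy := hnear x y (hyb'.trans hrδ)
            have ht : τ / 2 ≤ |u x - u y| := by
              have h3 : |u x| - |u y| ≤ |u x - u y| := abs_sub_abs_le_abs_sub _ _
              have h4 : v y = |u y| := by
                rcases min_choice |u y| T with h | h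
                · exact h
                · exfalso
                  have : τ ≤ T := min_le_right _ _
                  have : v y = T := h
                  linarith
              linarith
            have hxy : 0 < dist x y := by
              rw [dist_pos]; rintro rfl; simp at ht; linarith
            unfold sobKernel
            apply ENNReal.ofReal_le_ofReal
            apply div_le_div₀ (by positivity)
            · calc (τ/2) ^ p0 ≤ |u x - u y| ^ p0 :=
                    Real.rpow_le_rpow (by positivity) ht (by linarith)
                _ ≤ _ := Real.rpow_le_rpow_of_exponent_le (by linarith) hpy
            · positivity
            · calc dist x y ^ ((N:ℝ) + s * p x y) ≤ dist x y ^ ((N:ℝ) + s * p0) := by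
                    apply Real.rpow_le_rpow_of_exponent_ge hxy (by linarith)
                    nlinarith
                _ ≤ _ := Real.rpow_le_rpow hxy.le hyb'.le (by positivity)
        _ ≤ _ := setLIntegral_le_lintegral _ _
    have heq : τ ^ ps = (2 ^ p0 * (2 / ω) * A ^ θ * I ^ θ) *
        ((τ/2) ^ p0 / r ^ ((N:ℝ) + s * p0) * (r ^ N * ω / 2)) := by
      rw [Real.rpow_add hrpos, Real.rpow_natCast, hrs, Real.div_rpow hτpos.le (by norm_num),
        Real.mul_rpow hApos.le hI.le]
      conv_lhs => rw [hsplit]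
      field_simp
    rw [heq, ENNReal.ofReal_mul (by positivity)]
    apply mul_le_mul'
    · apply ENNReal.ofReal_le_ofReal
      rw [add_mul]
      have : 0 < (A / δ ^ N) ^ θ * I ^ θ := by positivity
      linarith
    · rw [ENNReal.ofReal_mul (by positivity)]
      exact hD.trans le_add_self
  · have hrδ' : δ ≤ r := not_lt.1 hrδ
    have h1 : δ ^ N ≤ A * I / τ ^ ps := by rw [← hrN]; gcongr
    have h2 : τ ^ ps ≤ A / δ ^ N * I := by
      rw [le_div_iff₀ (by positivity)] at h1
      rw [div_mul_eq_mul_div, le_div_iff₀ (by positivity)]; linarith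
    have h3 : τ ^ ps ≤ ((A / δ ^ N) ^ θ * I ^ θ) * |u x| ^ p0 := by
      rw [hsplit, ← Real.mul_rpow (by positivity) hI.le, mul_comm]
      gcongr
    calc _ ≤ ENNReal.ofReal (((A / δ ^ N) ^ θ * I ^ θ) * |u x| ^ p0) := ENNReal.ofReal_le_ofReal h3
      _ = ENNReal.ofReal ((A / δ ^ N) ^ θ * I ^ θ) * ENNReal.ofReal (|u x| ^ p0) :=
          ENNReal.ofReal_mul (by positivity)
      _ ≤ _ := by
        apply mul_le_mul' _ le_self_add
        apply ENNReal.ofReal_le_ofReal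
        rw [add_mul]
        have : 0 < 2 ^ p0 * (2 / ω) * A ^ θ * I ^ θ := by positivity
        linarith

lemma sobModular_univ {N : ℕ} (s : ℝ) (p : Euc N → Euc N → ℝ) (u : Euc N → ℝ) :
    sobModular Set.univ s p u =
      (∫⁻ x, ENNReal.ofReal (|u x| ^ (p x x))) + ∫⁻ x, ∫⁻ y, sobKernel s p u x y := by
  simp [sobModular]

lemma measurable_sobKernel {N : ℕ} (s : ℝ) (p : Euc N → Euc N → ℝ)
    (hpc : Continuous fun z : Euc N × Euc N => p z.1 z.2) (u : Euc N → ℝ) (hu : Measurable u) :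
    Measurable fun z : Euc N × Euc N => sobKernel s p u z.1 z.2 := by
  have hp := hpc.measurable
  unfold sobKernel
  have h1 : Measurable fun z : Euc N × Euc N => |u z.1 - u z.2| := by fun_prop
  have h2 : Measurable fun z : Euc N × Euc N => dist z.1 z.2 := by fun_prop
  exact ((h1.pow hp).div (h2.pow ((hp.const_mul s).const_add _))).ennreal_ofReal

lemma sobModular_congr {N : ℕ} (s : ℝ) (p : Euc N → Euc N → ℝ) (u v : Euc N → ℝ)
    (h : u =ᵐ[volume] v) : sobModular Set.univ s p u = sobModular Set.univ s p v := by
  rw [sobModular_univ, sobModular_univ]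
  congr 1
  · apply lintegral_congr_ae
    filter_upwards [h] with x hx
    rw [hx]
  · apply lintegral_congr_ae
    filter_upwards [h] with x hx
    apply lintegral_congr_ae
    filter_upwards [h] with y hy
    simp only [sobKernel, hx, hy]

lemma sob_bound_meas {N : ℕ} (hN : 0 < N) {s : ℝ} (hs : 0 < s) (p : Euc N → Euc N → ℝ)
    (hpc : Continuous fun z : Euc N × Euc N => p z.1 z.2)
    (p0 δ : ℝ) (hp0 : 1 < p0) (hsp : s * p0 < N) (hδ : 0 < δ) (hδ1 : δ < 1)
    (hdiag : ∀ x, p x x = p0)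
    (hnear : ∀ x y, dist x y < δ → p0 ≤ p x y) (ps : ℝ)
    (hps : ps = N * p0 / (N - s * p0)) :
    ∃ K : ℝ, 0 < K ∧ ∀ u : Euc N → ℝ, Measurable u → sobModular Set.univ s p u ≤ 1 →
      ∫⁻ x, ENNReal.ofReal (|u x| ^ ps) ≤ ENNReal.ofReal K := by
  obtain ⟨C, hC, hpt⟩ := sob_point hN hs p p0 δ hp0 hsp hδ hδ1 hnear ps _ hps rfl
  set θ := s * p0 / N with hθ
  have hNr : (0:ℝ) < N := by exact_mod_cast hN
  have hθ0 : 0 < θ := by positivity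
  have hθ1 : θ < 1 := by rw [hθ, div_lt_one hNr]; exact hsp
  have hpsp0 : p0 ≤ ps := by
    rw [hps, le_div_iff₀ (by linarith)]
    have : 0 < p0 * (s * p0) := by positivity
    nlinarith
  set c : ℝ := 2 ^ (ps - p0) with hc
  have hcpos : 0 < c := by positivity
  refine ⟨max 1 ((c + C) ^ (1 / (1 - θ))), by positivity, ?_⟩
  intro u hu hM
  rw [sobModular_univ] at hM
  simp only [hdiag] at hM
  have hM1 : ∫⁻ x, ENNReal.ofReal (|u x| ^ p0) ≤ 1 := le_self_add.trans hM
  have hDm : Measurable fun x => ∫⁻ y, sobKernel s p u x y :=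
    (measurable_sobKernel s p hpc u hu).lintegral_prod_right'
  -- truncated bound
  have trunc : ∀ T : ℝ, 0 < T → ∫⁻ y, ENNReal.ofReal ((min |u y| T) ^ ps) ≤
      ENNReal.ofReal (max 1 ((c + C) ^ (1 / (1 - θ)))) := by
    intro T hT
    have hfin : ∫⁻ y, ENNReal.ofReal ((min |u y| T) ^ ps) ≤ ENNReal.ofReal (T ^ (ps - p0)) := by
      calc _ ≤ ∫⁻ y, ENNReal.ofReal (T ^ (ps - p0)) * ENNReal.ofReal (|u y| ^ p0) := by
            apply lintegral_mono
            intro y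
            simp only
            rw [← ENNReal.ofReal_mul (by positivity)]
            apply ENNReal.ofReal_le_ofReal
            have h0 : 0 ≤ min |u y| T := by positivity
            rcases h0.eq_or_lt with h | h
            · rw [← h, Real.zero_rpow (by linarith)]; positivity
            · have : ps = (ps - p0) + p0 := by ring
              rw [this, Real.rpow_add h]
              rw [← this]
              gcongr
              · exact min_le_right _ _
              · exact min_le_left _ _
        _ = ENNReal.ofReal (T ^ (ps - p0)) * ∫⁻ y, ENNReal.ofReal (|u y| ^ p0) :=
            lintegral_const_mul _ (by fun_prop)
        _ ≤ ENNReal.ofReal (T ^ (ps - p0)) * 1 := by gcongr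
        _ = _ := mul_one _
    obtain ⟨I, hI0, hI⟩ : ∃ I : ℝ, 0 ≤ I ∧ ∫⁻ y, ENNReal.ofReal ((min |u y| T) ^ ps) =
        ENNReal.ofReal I :=
      ⟨_, ENNReal.toReal_nonneg,
        (ENNReal.ofReal_toReal (ne_top_of_le_ne_top ENNReal.ofReal_ne_top hfin)).symm⟩
    rw [hI]
    apply ENNReal.ofReal_le_ofReal
    rcases le_or_gt I 1 with h1 | h1
    · exact h1.trans (le_max_left _ _)
    refine le_trans ?_ (le_max_right _ _)
    have hIpos : 0 < I := by linarith
    have hmain : ENNReal.ofReal I ≤ ENNReal.ofReal (c + C * I ^ θ) := by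
      calc ENNReal.ofReal I = ∫⁻ y, ENNReal.ofReal ((min |u y| T) ^ ps) := hI.symm
        _ ≤ ∫⁻ y, ENNReal.ofReal (c + C * I ^ θ) *
            (ENNReal.ofReal (|u y| ^ p0) + ∫⁻ z, sobKernel s p u y z) := by
            apply lintegral_mono
            intro y
            simp only
            rcases le_or_gt 2 (min |u y| T) with h2 | h2
            · refine (hpt u hu T hT I hIpos hI y h2).trans ?_
              gcongr
              linarith
            · have h0 : 0 ≤ min |u y| T := by positivity
              have : ENNReal.ofReal ((min |u y| T) ^ ps) ≤
                  ENNReal.ofReal c * ENNReal.ofReal (|u y| ^ p0) := by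
                rw [← ENNReal.ofReal_mul hcpos.le]
                apply ENNReal.ofReal_le_ofReal
                rcases h0.eq_or_lt with h | h
                · rw [← h, Real.zero_rpow (by linarith)]; positivity
                · have : ps = (ps - p0) + p0 := by ring
                  rw [this, Real.rpow_add h]
                  apply mul_le_mul _ _ (by positivity) (by positivity)
                  · exact Real.rpow_le_rpow h0 h2.le (by linarith)
                  · exact Real.rpow_le_rpow h0 (min_le_left _ _) (by linarith)
              refine this.trans (mul_le_mul' (ENNReal.ofReal_le_ofReal ?_) le_self_add)
              have : 0 < C * I ^ θ := by positivity
              linarith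
        _ = ENNReal.ofReal (c + C * I ^ θ) *
            ((∫⁻ y, ENNReal.ofReal (|u y| ^ p0)) + ∫⁻ y, ∫⁻ z, sobKernel s p u y z) := by
            rw [lintegral_const_mul _ (by fun_prop), lintegral_add_left (by fun_prop)]
        _ ≤ ENNReal.ofReal (c + C * I ^ θ) * 1 := by gcongr
        _ = _ := mul_one _
    have hmain' : I ≤ c + C * I ^ θ := (ENNReal.ofReal_le_ofReal_iff (by positivity)).1 hmain
    have h3 : (1:ℝ) ≤ I ^ θ := Real.one_le_rpow h1.le hθ0.le
    have h4 : I ≤ (c + C) * I ^ θ := by nlinarith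
    have h5 : I ^ (1 - θ) ≤ c + C := by
      rw [Real.rpow_sub hIpos, Real.rpow_one, div_le_iff₀ (by positivity)]
      exact h4
    calc I = (I ^ (1 - θ)) ^ (1 / (1 - θ)) := by
          rw [← Real.rpow_mul hIpos.le, mul_one_div_cancel (by linarith), Real.rpow_one]
      _ ≤ _ := Real.rpow_le_rpow (by positivity) h5 (by
          apply div_nonneg zero_le_one; linarith)
  -- Fatou
  have hlim : ∀ y, liminf (fun n : ℕ => ENNReal.ofReal ((min |u y| ((n:ℝ) + 1)) ^ ps)) atTop =
      ENNReal.ofReal (|u y| ^ ps) := by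
    intro y
    apply Tendsto.liminf_eq
    apply tendsto_const_nhds.congr'
    obtain ⟨n0, hn0⟩ := exists_nat_ge |u y|
    filter_upwards [eventually_ge_atTop n0] with n hn
    have : (n0:ℝ) ≤ n := by exact_mod_cast hn
    rw [min_eq_left (by linarith)]
  calc _ = ∫⁻ y, liminf (fun n : ℕ => ENNReal.ofReal ((min |u y| ((n:ℝ) + 1)) ^ ps)) atTop := by
        simp only [hlim]
    _ ≤ liminf (fun n : ℕ => ∫⁻ y, ENNReal.ofReal ((min |u y| ((n:ℝ) + 1)) ^ ps)) atTop :=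
        lintegral_liminf_le' (fun n => by fun_prop)
    _ ≤ _ := by
        refine le_trans (liminf_le_liminf (v := fun _ => ENNReal.ofReal
          (max 1 ((c + C) ^ (1 / (1 - θ))))) (Eventually.of_forall fun n => trunc _ (by positivity)))
          ?_
        simp

/-- Bound in `L^{q(·)}`. -/
lemma sob_bound {N : ℕ} (hN : 0 < N) {s : ℝ} (hs : 0 < s) (p : Euc N → Euc N → ℝ)
    (hpc : Continuous fun z : Euc N × Euc N => p z.1 z.2)
    (p0 δ : ℝ) (hp0 : 1 < p0) (hsp : s * p0 < N) (hδ : 0 < δ) (hδ1 : δ < 1)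
    (hdiag : ∀ x, p x x = p0)
    (hnear : ∀ x y, dist x y < δ → p0 ≤ p x y)
    (q : Euc N → ℝ) (hpq : ∀ x, p0 ≤ q x)
    (hq : ∀ x, q x ≤ N * p0 / (N - s * p0)) :
    ∃ K : ℝ, 0 < K ∧ ∀ u : Euc N → ℝ, AEStronglyMeasurable u volume →
      sobModular Set.univ s p u ≤ 1 →
      ∫⁻ x, ENNReal.ofReal (|u x| ^ q x) ≤ ENNReal.ofReal K := by
  obtain ⟨K, hK, h⟩ := sob_bound_meas hN hs p hpc p0 δ hp0 hsp hδ hδ1 hdiag hnear _ rfl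
  refine ⟨1 + K, by positivity, ?_⟩
  intro u hu hM
  have hm : Measurable (hu.mk u) := hu.stronglyMeasurable_mk.measurable
  rw [sobModular_congr s p u _ hu.ae_eq_mk] at hM
  have e : ∫⁻ x, ENNReal.ofReal (|u x| ^ q x) = ∫⁻ x, ENNReal.ofReal (|hu.mk u x| ^ q x) := by
    apply lintegral_congr_ae
    filter_upwards [hu.ae_eq_mk] with x hx
    rw [hx]
  rw [e]
  have h1 := h _ hm hM
  rw [sobModular_univ] at hM
  simp only [hdiag] at hM
  have hM1 : ∫⁻ x, ENNReal.ofReal (|hu.mk u x| ^ p0) ≤ 1 := le_self_add.trans hM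
  rw [ENNReal.ofReal_add zero_le_one hK.le, ENNReal.ofReal_one]
  refine le_trans ?_ (add_le_add hM1 h1)
  rw [← lintegral_add_left (by fun_prop)]
  apply lintegral_mono
  intro x
  simp only
  rcases le_or_gt 1 |hu.mk u x| with h2 | h2
  · refine le_trans (ENNReal.ofReal_le_ofReal ?_) le_add_self
    exact Real.rpow_le_rpow_of_exponent_le h2 (hq x)
  · refine le_trans (ENNReal.ofReal_le_ofReal ?_) le_self_add
    have h0 : 0 ≤ |hu.mk u x| := abs_nonneg _
    have := hpq x
    rcases h0.eq_or_lt with h | h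
    · rw [← h, Real.zero_rpow (by linarith), Real.zero_rpow (by linarith)]
    · exact Real.rpow_le_rpow_of_exponent_ge h h2.le (hpq x)

lemma abs_le_one_add_rpow {t a : ℝ} (ht : 0 ≤ t) (ha : 1 ≤ a) : t ≤ 1 + t ^ a := by
  rcases le_or_gt t 1 with h | h
  · have : 0 ≤ t ^ a := by positivity
    linarith
  · have : t ^ (1:ℝ) ≤ t ^ a := Real.rpow_le_rpow_of_exponent_le h.le ha
    rw [Real.rpow_one] at this
    linarith

lemma lint_enorm {N : ℕ} {s : ℝ} (p : Euc N → Euc N → ℝ)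
    (hp1 : ∀ x y, 1 ≤ p x y)
    (u : Euc N → ℝ) (hM : sobModular Set.univ s p u ≤ 1)
    (ν : Measure (Euc N)) (hν : ν ≤ volume) :
    ∫⁻ x, ‖u x‖ₑ ∂ν ≤ ν univ + 1 := by
  rw [sobModular_univ] at hM
  have hM1 : ∫⁻ x, ENNReal.ofReal (|u x| ^ p x x) ≤ 1 := le_self_add.trans hM
  calc _ ≤ ∫⁻ x, (1 + ENNReal.ofReal (|u x| ^ p x x)) ∂ν := by
        apply lintegral_mono
        intro x
        simp only
        rw [Real.enorm_eq_ofReal_abs, ← ENNReal.ofReal_one, ← ENNReal.ofReal_add zero_le_one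
          (by positivity)]
        exact ENNReal.ofReal_le_ofReal (abs_le_one_add_rpow (abs_nonneg _) (hp1 x x))
    _ = ν univ + ∫⁻ x, ENNReal.ofReal (|u x| ^ p x x) ∂ν := by
        rw [lintegral_add_left measurable_const]; simp
    _ ≤ _ := by
        gcongr
        exact (lintegral_mono' hν le_rfl).trans hM1

lemma kernel_est {N : ℕ} {s : ℝ} (hs : 0 < s) (p : Euc N → Euc N → ℝ) (pp : ℝ)
    (hp1 : ∀ x y, 1 ≤ p x y) (hpp : ∀ x y, p x y ≤ pp)
    (u : Euc N → ℝ) (ε h : ℝ) (hε : 0 < ε) (hε1 : ε ≤ 1) (hh1 : 2 * h ≤ 1)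
    (x y : Euc N) (hxy : dist x y < 2 * h) :
    ‖u x - u y‖ₑ ≤ ENNReal.ofReal ε +
      ENNReal.ofReal (ε ^ (1 - pp) * (2 * h) ^ ((N:ℝ) + s)) * sobKernel s p u x y := by
  rw [Real.enorm_eq_ofReal_abs]
  set t := |u x - u y| with ht
  rcases le_or_gt t ε with h1 | h1
  · exact (ENNReal.ofReal_le_ofReal h1).trans le_self_add
  have ht0 : 0 < t := hε.trans h1
  have hd : 0 < dist x y := by
    rw [dist_pos]; rintro rfl; simp [ht] at ht0
  have hh : 0 < h := by linarith
  refine le_trans ?_ le_add_self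
  unfold sobKernel
  rw [← ENNReal.ofReal_mul (by positivity)]
  apply ENNReal.ofReal_le_ofReal
  rw [← ht]
  have hP1 := hp1 x y
  have hP2 := hpp x y
  set P := p x y
  have e1 : t ≤ ε ^ (1 - pp) * t ^ P := by
    calc t = t ^ (1 - P) * t ^ P := by
          rw [← Real.rpow_add ht0]; simp
      _ ≤ ε ^ (1 - pp) * t ^ P := by
          gcongr
          calc t ^ (1 - P) ≤ ε ^ (1 - P) :=
                Real.rpow_le_rpow_of_nonpos hε h1.le (by linarith)
            _ ≤ _ := Real.rpow_le_rpow_of_exponent_ge hε hε1 (by linarith)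
  have e2 : dist x y ^ ((N:ℝ) + s * P) ≤ (2 * h) ^ ((N:ℝ) + s) := by
    calc _ ≤ (2 * h) ^ ((N:ℝ) + s * P) := Real.rpow_le_rpow hd.le hxy.le (by positivity)
      _ ≤ _ := Real.rpow_le_rpow_of_exponent_ge (by positivity) hh1 (by nlinarith)
  calc t ≤ ε ^ (1 - pp) * t ^ P := e1
    _ = ε ^ (1 - pp) * dist x y ^ ((N:ℝ) + s * P) * (t ^ P / dist x y ^ ((N:ℝ) + s * P)) := by
        field_simp
    _ ≤ _ := by gcongr

lemma avg_est {N : ℕ} {s : ℝ} (hs : 0 < s) (p : Euc N → Euc N → ℝ) (pp : ℝ)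
    (hp1 : ∀ x y, 1 ≤ p x y) (hpp : ∀ x y, p x y ≤ pp)
    (u : Euc N → ℝ) (hu : Measurable u) (hM : sobModular Set.univ s p u ≤ 1)
    (hkm : Measurable fun z : Euc N × Euc N => sobKernel s p u z.1 z.2)
    (ε h : ℝ) (hε : 0 < ε) (hε1 : ε ≤ 1) (hh : 0 < h) (hh1 : 2 * h ≤ 1)
    (ω : ℝ) (hω : 0 < ω) (hωe : volume (Metric.ball (0 : Euc N) 1) = ENNReal.ofReal ω)
    (x d : Euc N) (hxd : dist x d < h) :
    ‖u x - ⨍ y in Metric.ball d h, u y‖ₑ ≤ ENNReal.ofReal ε +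
      ENNReal.ofReal (ε ^ (1 - pp) * 2 ^ ((N:ℝ) + s) / ω * h ^ s) * ∫⁻ y, sobKernel s p u x y := by
  set B := Metric.ball d h with hB
  have hball : volume B = ENNReal.ofReal (h ^ N * ω) := by
    rw [hB, Measure.addHaar_ball_of_pos _ _ hh, hωe, ← ENNReal.ofReal_mul (by positivity)]
    simp
  have hV : 0 < h ^ N * ω := by positivity
  have hreal : volume.real B = h ^ N * ω := by
    rw [Measure.real, hball, ENNReal.toReal_ofReal hV.le]
  have hBfin : volume B ≠ ⊤ := by rw [hball]; exact ENNReal.ofReal_ne_top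
  have hint : IntegrableOn u B := by
    refine ⟨hu.aestronglyMeasurable, ?_⟩
    refine lt_of_le_of_lt (lint_enorm p hp1 u hM _ Measure.restrict_le_self) ?_
    rw [Measure.restrict_apply_univ]
    exact ENNReal.add_lt_top.2 ⟨hBfin.lt_top, by simp⟩
  have e1 : u x - ⨍ y in B, u y = (h ^ N * ω)⁻¹ • ∫ y in B, (u x - u y) := by
    rw [setAverage_eq, integral_sub (integrableOn_const (C := u x) hBfin : Integrable (fun _ => u x) (volume.restrict B)) hint, setIntegral_const, hreal]
    simp only [smul_eq_mul]
    field_simp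
  have e2 : ∫⁻ y in B, ‖u x - u y‖ₑ ≤ ENNReal.ofReal ε * ENNReal.ofReal (h ^ N * ω) +
      ENNReal.ofReal (ε ^ (1 - pp) * (2 * h) ^ ((N:ℝ) + s)) * ∫⁻ y, sobKernel s p u x y := by
    calc _ ≤ ∫⁻ y in B, (ENNReal.ofReal ε +
          ENNReal.ofReal (ε ^ (1 - pp) * (2 * h) ^ ((N:ℝ) + s)) * sobKernel s p u x y) := by
          apply setLIntegral_mono' measurableSet_ball
          intro y hy
          apply kernel_est hs p pp hp1 hpp u ε h hε hε1 hh1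
          have : dist y d < h := hy
          calc dist x y ≤ dist x d + dist y d := dist_triangle_right _ _ _
            _ < _ := by linarith
      _ = ENNReal.ofReal ε * volume B + ENNReal.ofReal (ε ^ (1 - pp) * (2 * h) ^ ((N:ℝ) + s)) *
            ∫⁻ y in B, sobKernel s p u x y := by
          rw [lintegral_add_left measurable_const, setLIntegral_const,
            lintegral_const_mul' _ _ ENNReal.ofReal_ne_top]
      _ ≤ _ := by
          rw [hball]
          gcongr
          exact Measure.restrict_le_self
  rw [e1, enorm_smul]
  calc _ ≤ ENNReal.ofReal ((h ^ N * ω)⁻¹) * (ENNReal.ofReal ε * ENNReal.ofReal (h ^ N * ω) +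
      ENNReal.ofReal (ε ^ (1 - pp) * (2 * h) ^ ((N:ℝ) + s)) * ∫⁻ y, sobKernel s p u x y) := by
        rw [Real.enorm_eq_ofReal (by positivity)]
        gcongr
        exact (enorm_integral_le_lintegral_enorm _).trans e2
    _ = _ := by
        rw [mul_add, ← ENNReal.ofReal_mul hε.le, ← ENNReal.ofReal_mul (by positivity),
          ← mul_assoc (ENNReal.ofReal (h ^ N * ω)⁻¹) (ENNReal.ofReal _),
          ← ENNReal.ofReal_mul (by positivity)]
        congr 2
        · congr 1; field_simp
        · congr 1
          rw [Real.mul_rpow (by norm_num) hh.le, Real.rpow_add hh, Real.rpow_natCast]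
          field_simp

lemma avg_bdd {N : ℕ} {s : ℝ} (p : Euc N → Euc N → ℝ)
    (hp1 : ∀ x y, 1 ≤ p x y)
    (u : Euc N → ℝ) (hM : sobModular Set.univ s p u ≤ 1)
    (h : ℝ) (hh : 0 < h)
    (ω : ℝ) (hω : 0 < ω) (hωe : volume (Metric.ball (0 : Euc N) 1) = ENNReal.ofReal ω)
    (d : Euc N) :
    |⨍ y in Metric.ball d h, u y| ≤ (h ^ N * ω)⁻¹ * (h ^ N * ω + 1) := by
  set B := Metric.ball d h with hB
  have hball : volume B = ENNReal.ofReal (h ^ N * ω) := by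
    rw [hB, Measure.addHaar_ball_of_pos _ _ hh, hωe, ← ENNReal.ofReal_mul (by positivity)]
    simp
  have hV : 0 < h ^ N * ω := by positivity
  have hreal : volume.real B = h ^ N * ω := by
    rw [Measure.real, hball, ENNReal.toReal_ofReal hV.le]
  rw [setAverage_eq, hreal, smul_eq_mul, abs_mul, abs_of_pos (by positivity)]
  gcongr
  have h1 := (enorm_integral_le_lintegral_enorm (μ := volume.restrict B) u).trans
    (lint_enorm p hp1 u hM _ Measure.restrict_le_self)
  rw [Measure.restrict_apply_univ, hball, Real.enorm_eq_ofReal_abs, ← ENNReal.ofReal_one,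
    ← ENNReal.ofReal_add hV.le zero_le_one] at h1
  exact (ENNReal.ofReal_le_ofReal_iff (by positivity)).1 h1

set_option maxHeartbeats 1600000 in
lemma ae_subseq {N : ℕ} {s : ℝ} (hs : 0 < s) (p : Euc N → Euc N → ℝ)
    (hpc : Continuous fun z : Euc N × Euc N => p z.1 z.2) (pp : ℝ)
    (hp1 : ∀ x y, 1 ≤ p x y) (hpp : ∀ x y, p x y ≤ pp)
    (un : ℕ → Euc N → ℝ) (hun : ∀ n, Measurable (un n))
    (hM : ∀ n, sobModular Set.univ s p (un n) ≤ 1) :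
    ∃ (U : Euc N → ℝ) (φ : ℕ → ℕ), StrictMono φ ∧ Measurable U ∧
      ∀ᵐ x, Tendsto (fun k => un (φ k) x) atTop (𝓝 (U x)) := by
  -- finite measure
  obtain ⟨ν, hνfin, hνle, hνac⟩ : ∃ ν : Measure (Euc N), IsFiniteMeasure ν ∧ ν ≤ volume ∧
      (volume : Measure (Euc N)) ≪ ν := by
    have hi : Integrable (fun x : Euc N => (1 + ‖x‖) ^ (-((N:ℝ) + 1))) volume := by
      apply integrable_one_add_norm
      simp
    refine ⟨volume.withDensity fun x => ENNReal.ofReal ((1 + ‖x‖) ^ (-((N:ℝ) + 1))),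
      isFiniteMeasure_withDensity_ofReal hi.2, ?_, ?_⟩
    · conv_rhs => rw [← withDensity_one (μ := (volume : Measure (Euc N)))]
      apply withDensity_mono
      refine Eventually.of_forall fun x => ?_
      simp only [Pi.one_apply, ENNReal.ofReal_le_one]
      apply Real.rpow_le_one_of_one_le_of_nonpos
      · linarith [norm_nonneg x]
      · have : (0:ℝ) ≤ N := by positivity
        linarith
    · apply withDensity_absolutelyContinuous' hi.aestronglyMeasurable.aemeasurable.ennreal_ofReal
      refine Eventually.of_forall fun x => ?_
      have : 0 < (1 + ‖x‖) ^ (-((N:ℝ) + 1)) := by positivity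
      simpa using this
  set ω : ℝ := (volume (Metric.ball (0 : Euc N) 1)).toReal with hω
  have hωe : volume (Metric.ball (0 : Euc N) 1) = ENNReal.ofReal ω := by
    rw [hω, ENNReal.ofReal_toReal]; exact measure_ball_lt_top.ne
  have hωpos : 0 < ω := ENNReal.toReal_pos (Metric.measure_ball_pos _ _ one_pos).ne'
    measure_ball_lt_top.ne
  set h : ℕ → ℝ := fun k => 1 / (2 * ((k:ℝ) + 1)) with hh
  have hpos : ∀ k, 0 < h k := fun k => by simp only [hh]; positivity
  have hle : ∀ k, 2 * h k ≤ 1 := fun k => by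
    have : 2 * h k = 1 / ((k:ℝ) + 1) := by simp only [hh]; field_simp
    rw [this, div_le_one (by positivity)]
    have : (0:ℝ) ≤ k := by positivity
    linarith
  have hlim0 : Tendsto h atTop (𝓝 0) := by
    have := (tendsto_one_div_add_atTop_nhds_zero_nat (𝕜 := ℝ)).const_mul (1/2)
    rw [mul_zero] at this
    refine this.congr fun k => ?_
    simp only [hh]; field_simp
  set bk : ℕ → ℝ := fun k => ((h k) ^ N * ω)⁻¹ * ((h k) ^ N * ω + 1) with hbk
  set a : ℕ → ℕ × ℕ → ℝ := fun n ik =>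
    ⨍ y in Metric.ball (TopologicalSpace.denseSeq (Euc N) ik.1) (h ik.2), un n y with ha
  have hab : ∀ n ik, |a n ik| ≤ bk ik.2 := fun n ik =>
    avg_bdd p hp1 (un n) (hM n) _ (hpos _) ω hωpos hωe _
  obtain ⟨b, hbmem, φ, hφ, hφlim⟩ :=
    (isCompact_univ_pi (fun ik : ℕ × ℕ => isCompact_Icc (a := -bk ik.2) (b := bk ik.2))).tendsto_subseq
      (x := a) (fun n ik _ => abs_le.1 (hab n ik))
  rw [tendsto_pi_nhds] at hφlim
  have hbb : ∀ ik, |b ik| ≤ bk ik.2 := fun ik => abs_le.2 (hbmem ik trivial)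
  -- index function
  have hex : ∀ k (x : Euc N), ∃ i, dist x (TopologicalSpace.denseSeq (Euc N) i) < h k :=
    fun k x => (TopologicalSpace.denseRange_denseSeq (Euc N)).exists_dist_lt x (hpos k)
  classical
  set j : ℕ → Euc N → ℕ := fun k x => Nat.find (hex k x) with hj
  have hjm : ∀ k, Measurable (j k) := fun k => by
    apply measurable_find (hex k)
    intro i
    exact measurableSet_lt (by fun_prop) measurable_const
  have hjd : ∀ k x, dist x (TopologicalSpace.denseSeq (Euc N) (j k x)) < h k :=
    fun k x => Nat.find_spec (hex k x)
  have hDint : ∀ n, ∫⁻ x, (∫⁻ y, sobKernel s p (un n) x y) ∂ν ≤ 1 := fun n => by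
    have := hM n
    rw [sobModular_univ] at this
    exact (lintegral_mono' hνle le_rfl).trans (le_add_self.trans this)
  -- approximations
  have happrox : ∀ ε : ℝ≥0∞, 0 < ε → ∃ Bf : Euc N → ℝ, Measurable Bf ∧ ∃ n0, ∀ n ≥ n0,
      ∫⁻ x, ‖un (φ n) x - Bf x‖ₑ ∂ν ≤ ε := by
    intro ε hε
    have hε3 : 0 < ε / 3 := ENNReal.div_pos hε.ne' (by simp)
    obtain ⟨e, he, he1, heε⟩ : ∃ e : ℝ, 0 < e ∧ e ≤ 1 ∧
        ENNReal.ofReal e * ν univ ≤ ε / 3 := by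
      have h1 : Tendsto (fun e : ℝ => ENNReal.ofReal e * ν univ) (𝓝[>] 0) (𝓝 0) := by
        have h2 : Tendsto (fun e : ℝ => ENNReal.ofReal e) (𝓝[>] 0) (𝓝 0) := by
          have := ENNReal.tendsto_ofReal
            (tendsto_id.mono_left (nhdsWithin_le_nhds (a := (0:ℝ)) (s := Ioi 0)))
          simpa using this
        have h3 := ENNReal.Tendsto.mul_const (b := ν univ) h2 (Or.inr (measure_ne_top _ _))
        simpa using h3
      have h2 := (ENNReal.tendsto_nhds_zero.1 h1) (ε/3) hε3
      have h3 : ∀ᶠ e : ℝ in 𝓝[>] 0, e ≤ 1 := nhdsWithin_le_nhds (ge_mem_nhds one_pos)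
      obtain ⟨e, h4, h5, h6⟩ := (h2.and (h3.and self_mem_nhdsWithin)).exists
      exact ⟨e, h6, h5, h4⟩
    obtain ⟨k, hk⟩ : ∃ k, ENNReal.ofReal (e ^ (1 - pp) * 2 ^ ((N:ℝ) + s) / ω * (h k) ^ s) ≤
        ε / 3 := by
      have h1 : Tendsto (fun k => ENNReal.ofReal (e ^ (1 - pp) * 2 ^ ((N:ℝ) + s) / ω * (h k) ^ s))
          atTop (𝓝 0) := by
        have h2 := (hlim0.rpow_const (p := s) (Or.inr hs.le)).const_mul
          (e ^ (1 - pp) * 2 ^ ((N:ℝ) + s) / ω)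
        rw [Real.zero_rpow hs.ne', mul_zero] at h2
        simpa using ENNReal.tendsto_ofReal h2
      exact ((ENNReal.tendsto_nhds_zero.1 h1) (ε/3) hε3).exists
    have hm1 : ∀ c : ℕ × ℕ → ℝ, Measurable fun x => c (j k x, k) := fun c =>
      (measurable_from_nat (f := fun i => c (i, k))).comp (hjm k)
    have hm2 : ∀ n, Measurable fun x => ‖a (φ n) (j k x, k) - b (j k x, k)‖ₑ := fun n =>
      (measurable_from_nat (f := fun i => ‖a (φ n) (i, k) - b (i, k)‖ₑ)).comp (hjm k)
    refine ⟨fun x => b (j k x, k), hm1 b, ?_⟩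
    have hdct : Tendsto (fun n => ∫⁻ x, ‖a (φ n) (j k x, k) - b (j k x, k)‖ₑ ∂ν) atTop (𝓝 0) := by
      have := tendsto_lintegral_of_dominated_convergence' (μ := ν)
        (F := fun n x => ‖a (φ n) (j k x, k) - b (j k x, k)‖ₑ) (f := fun _ => 0)
        (fun _ => ENNReal.ofReal (bk k + bk k))
        (fun n => (hm2 n).aemeasurable)
        (fun n => Eventually.of_forall fun x => by
          simp only
          rw [Real.enorm_eq_ofReal_abs]
          apply ENNReal.ofReal_le_ofReal
          exact (abs_sub _ _).trans (add_le_add (hab _ _) (hbb _)))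
        (by
          rw [lintegral_const]
          exact ENNReal.mul_ne_top ENNReal.ofReal_ne_top (measure_ne_top _ _))
        (by
          refine Eventually.of_forall fun x => ?_
          have := ((hφlim (j k x, k)).sub_const (b (j k x, k))).enorm
          simpa using this)
      simpa using this
    obtain ⟨n0, hn0⟩ := eventually_atTop.1 ((ENNReal.tendsto_nhds_zero.1 hdct) (ε/3) hε3)
    refine ⟨n0, fun n hn => ?_⟩
    set c := ENNReal.ofReal (e ^ (1 - pp) * 2 ^ ((N:ℝ) + s) / ω * (h k) ^ s) with hc
    calc _ ≤ ∫⁻ x, ((ENNReal.ofReal e + c * ∫⁻ y, sobKernel s p (un (φ n)) x y) +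
          ‖a (φ n) (j k x, k) - b (j k x, k)‖ₑ) ∂ν := by
          apply lintegral_mono
          intro x
          simp only
          have e1 : un (φ n) x - b (j k x, k) = (un (φ n) x - a (φ n) (j k x, k)) +
            (a (φ n) (j k x, k) - b (j k x, k)) := by ring
          rw [e1]
          refine (enorm_add_le _ _).trans ?_
          gcongr
          exact avg_est hs p pp hp1 hpp _ (hun _) (hM _)
            (measurable_sobKernel s p hpc _ (hun _)) e (h k) he he1 (hpos k) (hle k) ω hωpos hωe
            x _ (hjd k x)
      _ = ENNReal.ofReal e * ν univ + c * (∫⁻ x, (∫⁻ y, sobKernel s p (un (φ n)) x y) ∂ν) +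
          ∫⁻ x, ‖a (φ n) (j k x, k) - b (j k x, k)‖ₑ ∂ν := by
          rw [lintegral_add_right _ (hm2 n),
            lintegral_add_left measurable_const, lintegral_const,
            lintegral_const_mul' _ _ ENNReal.ofReal_ne_top]
      _ ≤ ε / 3 + ε / 3 * 1 + ε / 3 := by
          gcongr
          · exact hDint _
          · exact hn0 n hn
      _ = ε := by rw [mul_one, ENNReal.add_thirds]
  have hmem : ∀ n, MemLp (un (φ n)) 1 ν := fun n => by
    rw [memLp_one_iff_integrable]
    exact ⟨(hun _).aestronglyMeasurable, lt_of_le_of_lt (lint_enorm p hp1 _ (hM _) ν hνle)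
      (ENNReal.add_lt_top.2 ⟨measure_lt_top _ _, by simp⟩)⟩
  have hcau : CauchySeq fun n => (hmem n).toLp := by
    rw [EMetric.cauchySeq_iff]
    intro ε hε
    obtain ⟨ε', hε'0, hε'⟩ := exists_between hε
    obtain ⟨Bf, hBm, n0, hn0⟩ := happrox (ε' / 2) (ENNReal.half_pos hε'0.ne')
    refine ⟨n0, fun m hm n hn => lt_of_le_of_lt ?_ hε'⟩
    rw [Lp.edist_toLp_toLp, eLpNorm_one_eq_lintegral_enorm]
    calc _ ≤ ∫⁻ x, (‖un (φ m) x - Bf x‖ₑ + ‖un (φ n) x - Bf x‖ₑ) ∂ν := by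
          apply lintegral_mono
          intro x
          simp only [Pi.sub_apply]
          have e1 : un (φ m) x - un (φ n) x = (un (φ m) x - Bf x) - (un (φ n) x - Bf x) := by ring
          rw [e1]
          exact enorm_sub_le
      _ = _ := lintegral_add_left ((hun _).sub hBm).enorm _
      _ ≤ ε' / 2 + ε' / 2 := add_le_add (hn0 m hm) (hn0 n hn)
      _ = ε' := ENNReal.add_halves _
  obtain ⟨G, hG⟩ := cauchySeq_tendsto_of_complete hcau
  obtain ⟨ψ, hψ, hae⟩ := (tendstoInMeasure_of_tendsto_Lp hG).exists_seq_tendsto_ae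
  refine ⟨G, φ ∘ ψ, hφ.comp hψ, (Lp.stronglyMeasurable G).measurable, ?_⟩
  apply hνac.ae_le
  have h1 : ∀ᵐ x ∂ν, ∀ n, ((hmem n).toLp : Euc N → ℝ) x = un (φ n) x :=
    ae_all_iff.2 fun n => (hmem n).coeFn_toLp
  filter_upwards [hae, h1] with x hx hx1
  simpa [hx1] using hx

lemma young_aux {w b r q : ℝ} (hw : 0 ≤ w) (hb : 0 ≤ b) (hr : 0 < r) (hrq : r < q) :
    w * b ^ r ≤ b ^ q + w ^ (q / (q - r)) := by
  have hqr : 0 < q - r := by linarith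
  rcases hb.eq_or_lt with rfl | hb'
  · rw [Real.zero_rpow hr.ne']; simp only [mul_zero]; positivity
  rcases le_or_gt w (b ^ (q - r)) with h | h
  · have : w * b ^ r ≤ b ^ q := by
      calc w * b ^ r ≤ b ^ (q - r) * b ^ r := by gcongr
        _ = b ^ q := by rw [← Real.rpow_add hb']; congr 1; ring
    have h2 : 0 ≤ w ^ (q / (q - r)) := by positivity
    linarith
  · have hw' : 0 < w := lt_trans (by positivity) h
    have h1 : b ≤ w ^ (1 / (q - r)) := by
      calc b = (b ^ (q - r)) ^ (1 / (q - r)) := by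
            rw [← Real.rpow_mul hb, mul_one_div_cancel hqr.ne', Real.rpow_one]
        _ ≤ _ := Real.rpow_le_rpow (by positivity) h.le (by positivity)
    have h2 : w * b ^ r ≤ w ^ (q / (q - r)) := by
      calc w * b ^ r ≤ w * (w ^ (1 / (q - r))) ^ r := by gcongr
        _ = w ^ (1 + 1 / (q - r) * r) := by
            rw [← Real.rpow_mul hw, Real.rpow_add hw', Real.rpow_one]
        _ = _ := by congr 1; field_simp; ring
    have h3 : 0 ≤ b ^ q := by positivity
    linarith

lemma young_eps {w b r q η δ rp : ℝ} (hb : 0 ≤ b) (hr : 0 < r) (hδ : 0 < δ)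
    (hrq : r + δ ≤ q) (hrp : r ≤ rp) (hη : 0 < η) (hη1 : η ≤ 1) :
    ENNReal.ofReal w * ENNReal.ofReal (b ^ r) ≤ ENNReal.ofReal (η ^ δ) * ENNReal.ofReal (b ^ q) +
      ENNReal.ofReal (η ^ (-rp)) * ENNReal.ofReal (|w| ^ (q / (q - r))) := by
  rcases le_or_gt w 0 with hw | hw
  · rw [ENNReal.ofReal_of_nonpos hw]; simp
  rw [abs_of_pos hw, ← ENNReal.ofReal_mul hw.le, ← ENNReal.ofReal_mul (by positivity),
    ← ENNReal.ofReal_mul (by positivity), ← ENNReal.ofReal_add (by positivity) (by positivity)]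
  apply ENNReal.ofReal_le_ofReal
  have h := young_aux (w := w) (b := η * b) (r := r) (q := q) hw.le (by positivity) hr (by linarith)
  rw [Real.mul_rpow hη.le hb, Real.mul_rpow hη.le hb] at h
  have h2 : w * b ^ r = η ^ (-r) * (w * (η ^ r * b ^ r)) := by
    rw [Real.rpow_neg hη.le]; field_simp
  rw [h2]
  calc _ ≤ η ^ (-r) * (η ^ q * b ^ q + w ^ (q / (q - r))) := by gcongr
    _ = η ^ (q - r) * b ^ q + η ^ (-r) * w ^ (q / (q - r)) := by
        rw [mul_add, ← mul_assoc, ← Real.rpow_add hη]; congr 3; ring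
    _ ≤ _ := by
        apply add_le_add
        · apply mul_le_mul_of_nonneg_right _ (by positivity)
          exact Real.rpow_le_rpow_of_exponent_ge hη hη1 (by linarith)
        · apply mul_le_mul_of_nonneg_right _ (by positivity)
          exact Real.rpow_le_rpow_of_exponent_ge hη hη1 (by linarith)

lemma mod_le {N : ℕ} (w : Euc N → ℝ) (hwmeas : Measurable w) (r u : Euc N → ℝ) :
    varModular (volume.withDensity fun x => ENNReal.ofReal (w x)) r u ≤
      ∫⁻ x, ENNReal.ofReal (w x) * ENNReal.ofReal (|u x| ^ r x) :=
  lintegral_withDensity_le_lintegral_mul _ hwmeas.ennreal_ofReal _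

lemma mod_bound {N : ℕ} (q r : Euc N → ℝ) (hqm : Measurable q) (hrmeas : Measurable r)
    (hr1 : ∀ x, 1 < r x)
    (δ : ℝ) (hδ : 0 < δ) (hqr : ∀ x, r x + δ ≤ q x)
    (w : Euc N → ℝ) (hwmeas : Measurable w) (u : Euc N → ℝ) :
    varModular (volume.withDensity fun x => ENNReal.ofReal (w x)) r u ≤
      (∫⁻ x, ENNReal.ofReal (|u x| ^ q x)) +
        varModular volume (fun x => q x / (q x - r x)) w := by
  refine (mod_le w hwmeas r u).trans ?_
  unfold varModular
  rw [← lintegral_add_right]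
  · apply lintegral_mono
    intro x
    have := young_eps (w := w x) (b := |u x|) (r := r x) (q := q x) (η := 1) (δ := δ) (rp := r x)
      (abs_nonneg _) (by linarith [hr1 x]) hδ (hqr x) le_rfl one_pos le_rfl
    simpa using this
  · have : Measurable fun x => |w x| := by fun_prop
    exact (this.pow (by fun_prop)).ennreal_ofReal

lemma mod_tendsto {N : ℕ} (q r : Euc N → ℝ) (hqm : Measurable q) (hrmeas : Measurable r)
    (hr1 : ∀ x, 1 < r x) (rp : ℝ) (hrp : ∀ x, r x ≤ rp)
    (δ : ℝ) (hδ : 0 < δ) (hqr : ∀ x, r x + δ ≤ q x)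
    (w : Euc N → ℝ) (hwmeas : Measurable w)
    (hw : varModular volume (fun x => q x / (q x - r x)) w < ⊤)
    (z : ℕ → Euc N → ℝ) (hz : ∀ n, AEMeasurable (z n) volume) (K : ℝ) (hK : 0 < K)
    (hzK : ∀ n, ∫⁻ x, ENNReal.ofReal (|z n x| ^ q x) ≤ ENNReal.ofReal K)
    (hz0 : ∀ᵐ x, Tendsto (fun n => z n x) atTop (𝓝 0)) :
    Tendsto (fun n => varModular (volume.withDensity fun x => ENNReal.ofReal (w x)) r (z n))
      atTop (𝓝 0) := by
  set H : ℕ → Euc N → ℝ≥0∞ := fun n x => ENNReal.ofReal (w x) * ENNReal.ofReal (|z n x| ^ r x)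
    with hH
  have hHm : ∀ n, AEMeasurable (H n) volume := by
    intro n
    have h1 : AEMeasurable (fun x => |z n x|) volume := (hz n).norm
    exact hwmeas.ennreal_ofReal.aemeasurable.mul (h1.pow hrmeas.aemeasurable).ennreal_ofReal
  set W : Euc N → ℝ≥0∞ := fun x => ENNReal.ofReal (|w x| ^ (q x / (q x - r x))) with hW
  have hWm : Measurable W := by
    have : Measurable fun x => |w x| := by fun_prop
    exact (this.pow (by fun_prop)).ennreal_ofReal
  have hWfin : ∫⁻ x, W x < ⊤ := hw
  have hH0 : ∀ᵐ x, Tendsto (fun n => H n x) atTop (𝓝 0) := by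
    filter_upwards [hz0] with x hx
    have h1 : Tendsto (fun n => |z n x| ^ r x) atTop (𝓝 0) := by
      have : Tendsto (fun n => |z n x|) atTop (𝓝 0) := by simpa using hx.abs
      have h2 := this.rpow_const (p := r x) (Or.inr (by linarith [hr1 x]))
      rwa [Real.zero_rpow (by linarith [hr1 x])] at h2
    have h2 := ENNReal.tendsto_ofReal h1
    have h3 := ENNReal.Tendsto.const_mul (a := ENNReal.ofReal (w x)) h2
      (Or.inr ENNReal.ofReal_ne_top)
    simpa [hH] using h3
  rw [ENNReal.tendsto_nhds_zero]
  intro ε hε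
  -- choose η
  obtain ⟨η, hη, hη1, hηε⟩ : ∃ η : ℝ, 0 < η ∧ η ≤ 1 ∧
      ENNReal.ofReal (η ^ δ) * ENNReal.ofReal K ≤ ε / 2 := by
    have h1 : Tendsto (fun η : ℝ => ENNReal.ofReal (η ^ δ) * ENNReal.ofReal K) (𝓝[>] 0) (𝓝 0) := by
      have h2 : Tendsto (fun η : ℝ => η ^ δ * K) (𝓝[>] 0) (𝓝 0) := by
        have : Continuous fun η : ℝ => η ^ δ * K :=
          (Real.continuous_rpow_const hδ.le).mul continuous_const
        have h3 := (this.tendsto 0).mono_left (nhdsWithin_le_nhds (s := Ioi 0))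
        simpa [Real.zero_rpow hδ.ne'] using h3
      have h3 := ENNReal.tendsto_ofReal h2
      rw [ENNReal.ofReal_zero] at h3
      refine h3.congr fun η => ?_
      rw [ENNReal.ofReal_mul' hK.le]
    have h2 := (ENNReal.tendsto_nhds_zero.1 h1) (ε/2) (ENNReal.half_pos hε.ne')
    have h3 : ∀ᶠ η : ℝ in 𝓝[>] 0, η ≤ 1 := nhdsWithin_le_nhds (ge_mem_nhds one_pos)
    obtain ⟨η, h4, h5, h6⟩ := (h2.and (h3.and self_mem_nhdsWithin)).exists
    exact ⟨η, h6, h5, h4⟩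
  set B : Euc N → ℝ≥0∞ := fun x => ENNReal.ofReal (η ^ (-rp)) * W x with hB
  have hBfin : ∫⁻ x, B x ≠ ⊤ := by
    rw [lintegral_const_mul _ hWm]
    exact ENNReal.mul_ne_top ENNReal.ofReal_ne_top hWfin.ne
  have hlim : Tendsto (fun n => ∫⁻ x, min (H n x) (B x)) atTop (𝓝 0) := by
    have := tendsto_lintegral_of_dominated_convergence' (μ := volume)
      (F := fun n x => min (H n x) (B x)) (f := fun _ => 0) B
      (fun n => (hHm n).min (hWm.const_mul _).aemeasurable)
      (fun n => Eventually.of_forall fun x => min_le_right _ _) hBfin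
      (by
        filter_upwards [hH0] with x hx
        exact tendsto_of_tendsto_of_tendsto_of_le_of_le tendsto_const_nhds hx
          (fun n => zero_le) (fun n => min_le_left _ _))
    simpa using this
  filter_upwards [(ENNReal.tendsto_nhds_zero.1 hlim) (ε/2) (ENNReal.half_pos hε.ne')] with n hn
  calc _ ≤ ∫⁻ x, H n x := mod_le w hwmeas r (z n)
    _ ≤ ∫⁻ x, (ENNReal.ofReal (η ^ δ) * ENNReal.ofReal (|z n x| ^ q x) + min (H n x) (B x)) := by
        apply lintegral_mono
        intro x
        have h1 : H n x ≤ ENNReal.ofReal (η ^ δ) * ENNReal.ofReal (|z n x| ^ q x) + B x :=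
          young_eps (abs_nonneg _) (by linarith [hr1 x]) hδ (hqr x) (hrp x) hη hη1
        simp only
        rcases min_choice (H n x) (B x) with h | h
        · rw [h]; exact le_add_self
        · rw [h]; exact h1
    _ = ENNReal.ofReal (η ^ δ) * (∫⁻ x, ENNReal.ofReal (|z n x| ^ q x)) +
          ∫⁻ x, min (H n x) (B x) := by
        rw [lintegral_add_right' _ ((hHm n).min (hWm.const_mul _).aemeasurable),
          lintegral_const_mul' _ _ ENNReal.ofReal_ne_top]
    _ ≤ ε / 2 + ε / 2 := by
        refine add_le_add (le_trans ?_ hηε) hn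
        gcongr
        exact hzK n
    _ = ε := ENNReal.add_halves ε

lemma scale_rpow {κ t a : ℝ} (hκ : 0 < κ) (hκ1 : κ ≤ 1) (ha : 1 ≤ a) :
    |κ * t| ^ a ≤ κ * |t| ^ a := by
  rw [abs_mul, abs_of_pos hκ, Real.mul_rpow hκ.le (abs_nonneg _)]
  gcongr
  calc κ ^ a ≤ κ ^ (1:ℝ) := Real.rpow_le_rpow_of_exponent_ge hκ hκ1 ha
    _ = κ := Real.rpow_one κ

lemma varModular_scale {α : Type*} [MeasurableSpace α] (μ : Measure α) (h : α → ℝ)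
    (hh : ∀ x, 1 ≤ h x) (u : α → ℝ) {κ : ℝ} (hκ : 0 < κ) (hκ1 : κ ≤ 1) :
    varModular μ h (fun x => κ * u x) ≤ ENNReal.ofReal κ * varModular μ h u := by
  unfold varModular
  rw [← lintegral_const_mul' _ _ ENNReal.ofReal_ne_top]
  apply lintegral_mono
  intro x
  simp only
  rw [← ENNReal.ofReal_mul hκ.le]
  exact ENNReal.ofReal_le_ofReal (scale_rpow hκ hκ1 (hh x))

lemma sobModular_scale {N : ℕ} (s : ℝ) (p : Euc N → Euc N → ℝ) (hp1 : ∀ x y, 1 ≤ p x y)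
    (u : Euc N → ℝ) {κ : ℝ} (hκ : 0 < κ) (hκ1 : κ ≤ 1) :
    sobModular Set.univ s p (fun x => κ * u x) ≤ ENNReal.ofReal κ * sobModular Set.univ s p u := by
  rw [sobModular_univ, sobModular_univ, mul_add]
  apply add_le_add
  · exact varModular_scale volume (fun x => p x x) (fun x => hp1 x x) u hκ hκ1
  · rw [← lintegral_const_mul' _ _ ENNReal.ofReal_ne_top]
    apply lintegral_mono
    intro x
    simp only
    rw [← lintegral_const_mul' _ _ ENNReal.ofReal_ne_top]
    apply lintegral_mono
    intro y
    simp only [sobKernel]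
    rw [← ENNReal.ofReal_mul hκ.le]
    apply ENNReal.ofReal_le_ofReal
    rw [← mul_sub, ← mul_div_assoc]
    gcongr
    exact scale_rpow hκ hκ1 (hp1 x y)

lemma sob_set_nonempty {N : ℕ} (s : ℝ) (p : Euc N → Euc N → ℝ) (hp1 : ∀ x y, 1 ≤ p x y)
    (u : Euc N → ℝ) (h : sobModular Set.univ s p u < ⊤) :
    {c : ℝ | 0 < c ∧ sobModular Set.univ s p (fun x => u x / c) ≤ 1}.Nonempty := by
  set m := (sobModular Set.univ s p u).toReal with hm
  have hm0 : 0 ≤ m := ENNReal.toReal_nonneg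
  have hme : sobModular Set.univ s p u = ENNReal.ofReal m := (ENNReal.ofReal_toReal h.ne).symm
  refine ⟨m + 1, by positivity, ?_⟩
  have h1 := sobModular_scale s p hp1 u (κ := (m + 1)⁻¹) (by positivity)
    (inv_le_one_of_one_le₀ (by linarith))
  have e : (fun x => u x / (m + 1)) = fun x => (m + 1)⁻¹ * u x := by
    funext x; rw [div_eq_inv_mul]
  rw [e]
  refine h1.trans ?_
  rw [hme, ← ENNReal.ofReal_mul (by positivity)]
  rw [ENNReal.ofReal_le_one, inv_mul_le_iff₀ (by positivity)]
  linarith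

lemma luxNorm_nonneg {α : Type*} [MeasurableSpace α] (μ : Measure α) (h u : α → ℝ) :
    0 ≤ luxNorm μ h u := Real.sInf_nonneg fun _ hc => hc.1.le

lemma luxNorm_le {α : Type*} [MeasurableSpace α] (μ : Measure α) (h u : α → ℝ) {c : ℝ}
    (hc : 0 < c) (hM : varModular μ h (fun x => u x / c) ≤ 1) : luxNorm μ h u ≤ c :=
  csInf_le ⟨0, fun _ hc => hc.1.le⟩ ⟨hc, hM⟩

lemma add_rpow_le {a b t tp : ℝ} (ht : 0 ≤ t) (htp : t ≤ tp) :
    |a - b| ^ t ≤ 2 ^ tp * (|a| ^ t + |b| ^ t) := by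
  have h1 : |a - b| ≤ 2 * max |a| |b| := by
    have := abs_sub a b
    have h2 := le_max_left |a| |b|
    have h3 := le_max_right |a| |b|
    linarith
  calc |a - b| ^ t ≤ (2 * max |a| |b|) ^ t := by gcongr
    _ = 2 ^ t * (max |a| |b|) ^ t := Real.mul_rpow (by norm_num) (by positivity)
    _ ≤ 2 ^ tp * (|a| ^ t + |b| ^ t) := by
        gcongr
        · norm_num
        · have h2 : 0 ≤ |a| ^ t := by positivity
          have h3 : 0 ≤ |b| ^ t := by positivity
          rcases max_choice |a| |b| with h | h <;> rw [h] <;> linarith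

lemma rpow_scale_le {t l a ap : ℝ} (ha : 0 ≤ a) (hap : a ≤ ap) (hl : 0 < l) :
    |t / l| ^ a ≤ (1 + l⁻¹) ^ ap * |t| ^ a := by
  rw [div_eq_inv_mul, abs_mul, Real.mul_rpow (abs_nonneg _) (abs_nonneg _),
    abs_of_pos (inv_pos.2 hl)]
  have hl' : 0 < l⁻¹ := inv_pos.2 hl
  gcongr
  calc l⁻¹ ^ a ≤ (1 + l⁻¹) ^ a := by gcongr; linarith
    _ ≤ _ := Real.rpow_le_rpow_of_exponent_le (by linarith) hap

/-- Theorem 3.5: compact imbedding of `W^{s,p(·,·)}(ℝ^N)` into the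
weighted variable exponent Lebesgue space `L^{r(·)}(w,ℝ^N)`. -/
theorem compact_imbedding_weighted {N : ℕ}
    (s : ℝ) (hs : s ∈ Set.Ioo (0 : ℝ) 1)
    (p : Euc N → Euc N → ℝ)
    (hpuc : UniformContinuous fun z : Euc N × Euc N => p z.1 z.2)
    (hpsym : ∀ x y, p x y = p y x)
    (pminus pplus : ℝ)
    (hpminus : IsGLB (Set.range fun z : Euc N × Euc N => p z.1 z.2) pminus)
    (hpplus : IsLUB (Set.range fun z : Euc N × Euc N => p z.1 z.2) pplus)
    (hpm1 : 1 < pminus) (hppN : pplus < (N : ℝ) / s)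
    (hLH : LogHolderType Set.univ p)
    (q : Euc N → ℝ) (hquc : UniformContinuous q)
    (qminus qplus : ℝ)
    (hqm : ∀ x, qminus ≤ q x) (hqp : ∀ x, q x ≤ qplus) (hqm1 : 1 < qminus)
    (hpq : ∀ x, p x x < q x)
    (hq : ∀ x : Euc N, ∃ ε > (0 : ℝ), ∀ y ∈ Metric.ball x ε,
      q y ≤ (N : ℝ) * locInf Set.univ p ε x x / ((N : ℝ) - s * locInf Set.univ p ε x x))
    (r : Euc N → ℝ) (hrc : Continuous r)
    (rminus rplus : ℝ)
    (hrm : ∀ x, rminus ≤ r x) (hrp : ∀ x, r x ≤ rplus) (hrm1 : 1 < rminus)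
    (hqr : ∃ δ > (0 : ℝ), ∀ x, r x + δ ≤ q x)
    (w : Euc N → ℝ) (hwmeas : Measurable w)
    (hwpos : ∀ᵐ x ∂(volume : Measure (Euc N)), 0 < w x)
    (hw : MemVarLp volume (fun x => q x / (q x - r x)) w) :
    (∃ C > (0 : ℝ), ∀ u : Euc N → ℝ, MemSob Set.univ s p u →
      MemVarLp (volume.withDensity fun x => ENNReal.ofReal (w x)) r u ∧
      luxNorm (volume.withDensity fun x => ENNReal.ofReal (w x)) r u ≤
        C * sobNorm Set.univ s p u) ∧
    ∀ un : ℕ → Euc N → ℝ, (∀ n, MemSob Set.univ s p (un n)) →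
      (∃ C : ℝ, ∀ n, sobNorm Set.univ s p (un n) ≤ C) →
      ∃ (u : Euc N → ℝ) (φ : ℕ → ℕ), StrictMono φ ∧
        MemVarLp (volume.withDensity fun x => ENNReal.ofReal (w x)) r u ∧
        Tendsto (fun k => luxNorm (volume.withDensity fun x => ENNReal.ofReal (w x)) r
          (fun x => un (φ k) x - u x)) atTop (𝓝 0) := by
  have hNpos : 0 < N := by
    rcases Nat.eq_zero_or_pos N with h | h
    · exfalso
      subst h
      have h1 := hpminus.1 ⟨((0 : Euc 0), (0 : Euc 0)), rfl⟩
      have h2 := hpplus.1 ⟨((0 : Euc 0), (0 : Euc 0)), rfl⟩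
      simp at hppN
      linarith
    · exact h
  have hNr : (0:ℝ) < N := by exact_mod_cast hNpos
  have hs0 : 0 < s := hs.1
  have hpc := hpuc.continuous
  have hpm : ∀ x y, pminus ≤ p x y := fun x y => hpminus.1 ⟨(x, y), rfl⟩
  have hpp : ∀ x y, p x y ≤ pplus := fun x y => hpplus.1 ⟨(x, y), rfl⟩
  have hp1 : ∀ x y, 1 ≤ p x y := fun x y => by linarith [hpm x y]
  obtain ⟨d, hd, hd1, hconst, hnear⟩ := exps hNpos p hpc pminus hpm hLH
  set p0 := p 0 0 with hp0
  have hdiag : ∀ x, p x x = p0 := fun x => hconst x 0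
  have hsN : s * pplus < N := by
    rw [lt_div_iff₀ hs0] at hppN; linarith
  have hsp : s * p0 < N := by
    have : s * p0 ≤ s * pplus := mul_le_mul_of_nonneg_left (hpp 0 0) hs0.le
    linarith
  have hp01 : 1 < p0 := by linarith [hpm 0 0]
  have hqstar : ∀ x, q x ≤ N * p0 / (N - s * p0) := by
    intro x
    obtain ⟨ε, hε, h⟩ := hq x
    refine (h x (Metric.mem_ball_self hε)).trans ?_
    set L := locInf Set.univ p ε x x with hL
    have hne : (Set.image2 p (Metric.ball x ε ∩ univ) (Metric.ball x ε ∩ univ)).Nonempty :=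
      ⟨p x x, x, ⟨Metric.mem_ball_self hε, trivial⟩, x, ⟨Metric.mem_ball_self hε, trivial⟩, rfl⟩
    have hL1 : L ≤ p0 := by
      rw [← hdiag x]
      apply csInf_le
      · refine ⟨pminus, ?_⟩
        rintro _ ⟨c, _, e, _, rfl⟩
        exact hpm c e
      · exact ⟨x, ⟨Metric.mem_ball_self hε, trivial⟩, x, ⟨Metric.mem_ball_self hε, trivial⟩, rfl⟩
    have hL2 : s * L ≤ s * p0 := mul_le_mul_of_nonneg_left hL1 hs0.le
    apply div_le_div₀ (by positivity) (by gcongr) (by linarith) (by linarith)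
  obtain ⟨K, hK, hKb⟩ := sob_bound hNpos hs0 p hpc p0 d hp01 hsp hd hd1 hdiag
    (fun x y h => by rw [← hdiag x]; exact hnear x y h) q
    (fun x => by rw [← hdiag x]; exact (hpq x).le) hqstar
  obtain ⟨δ, hδ, hqr⟩ := hqr
  have hqmeas := hquc.continuous.measurable
  have hrmeas := hrc.measurable
  have hr1 : ∀ x, 1 < r x := fun x => by linarith [hrm x]
  set μ := (volume : Measure (Euc N)).withDensity fun x => ENNReal.ofReal (w x) with hμ
  have hac : μ ≪ volume := withDensity_absolutelyContinuous _ _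
  set W := (varModular volume (fun x => q x / (q x - r x)) w).toReal with hW
  have hW0 : 0 ≤ W := ENNReal.toReal_nonneg
  have hWe : varModular volume (fun x => q x / (q x - r x)) w = ENNReal.ofReal W :=
    (ENNReal.ofReal_toReal hw.2.ne).symm
  have hmb : ∀ u : Euc N → ℝ, ∫⁻ x, ENNReal.ofReal (|u x| ^ q x) ≤ ENNReal.ofReal K →
      varModular μ r u ≤ ENNReal.ofReal (K + W) := by
    intro u hu
    refine (mod_bound q r hqmeas hrmeas hr1 δ hδ hqr w hwmeas u).trans ?_
    rw [hWe, ENNReal.ofReal_add hK.le hW0]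
    gcongr
  -- finiteness under scaling
  have hfinscale : ∀ (u : Euc N → ℝ) (c : ℝ), 0 < c →
      ∫⁻ x, ENNReal.ofReal (|u x| ^ q x) < ⊤ →
      ∫⁻ x, ENNReal.ofReal (|u x / c| ^ q x) ≤
        ENNReal.ofReal ((1 + c⁻¹) ^ qplus) * ∫⁻ x, ENNReal.ofReal (|u x| ^ q x) := by
    intro u c hc _
    rw [← lintegral_const_mul' _ _ ENNReal.ofReal_ne_top]
    apply lintegral_mono
    intro x
    simp only
    rw [← ENNReal.ofReal_mul (by positivity)]
    exact ENNReal.ofReal_le_ofReal (rpow_scale_le (by linarith [hqm x]) (hqp x) hc)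
  constructor
  · refine ⟨K + W + 1, by positivity, ?_⟩
    intro u hu
    obtain ⟨hum, huM⟩ := hu
    rw [Measure.restrict_univ] at hum
    have hne := sob_set_nonempty s p hp1 u huM
    have hkey : ∀ c : ℝ, 0 < c → sobModular Set.univ s p (fun x => u x / c) ≤ 1 →
        ∫⁻ x, ENNReal.ofReal (|u x / c| ^ q x) ≤ ENNReal.ofReal K := by
      intro c hc hcM
      refine hKb _ ?_ hcM
      simp only [div_eq_mul_inv]
      exact hum.mul_const _
    constructor
    · refine ⟨hum.mono_ac hac, ?_⟩
      obtain ⟨c, hc, hcM⟩ := hne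
      have h1 := hkey c hc hcM
      have h2 := hfinscale (fun x => u x / c) c⁻¹ (inv_pos.2 hc)
        (lt_of_le_of_lt h1 ENNReal.ofReal_lt_top)
      have e : (fun x => u x / c / c⁻¹) = u := by funext x; field_simp
      have h3 : ∫⁻ x, ENNReal.ofReal (|u x| ^ q x) < ⊤ := by
        have e2 : ∀ x, u x / c / c⁻¹ = u x := fun x => congrFun e x
        simp only [e2] at h2
        exact lt_of_le_of_lt h2 (ENNReal.mul_lt_top ENNReal.ofReal_lt_top
          (lt_of_le_of_lt h1 ENNReal.ofReal_lt_top))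
      refine lt_of_le_of_lt (mod_bound q r hqmeas hrmeas hr1 δ hδ hqr w hwmeas u) ?_
      exact ENNReal.add_lt_top.2 ⟨h3, hw.2⟩
    · rw [mul_comm, ← div_le_iff₀ (by positivity)]
      apply le_csInf hne
      rintro c ⟨hc, hcM⟩
      rw [div_le_iff₀ (by positivity)]
      apply luxNorm_le _ _ _ (by positivity)
      have h1 := hmb _ (hkey c hc hcM)
      have h2 := varModular_scale μ r (fun x => (hr1 x).le) (fun x => u x / c)
        (κ := (K + W + 1)⁻¹) (by positivity) (inv_le_one_of_one_le₀ (by linarith))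
      have e : (fun x => u x / (c * (K + W + 1))) = fun x => (K + W + 1)⁻¹ * (u x / c) := by
        funext x
        have : K + W + 1 ≠ 0 := by positivity
        field_simp
      rw [e]
      refine h2.trans ((mul_le_mul' le_rfl h1).trans ?_)
      rw [← ENNReal.ofReal_mul (by positivity), ENNReal.ofReal_le_one,
        inv_mul_le_iff₀ (by positivity)]
      linarith
  · intro un hun hbd
    obtain ⟨C, hC⟩ := hbd
    have hum : ∀ n, AEStronglyMeasurable (un n) volume := fun n => by
      have := (hun n).1
      rwa [Measure.restrict_univ] at this
    set c : ℝ := |C| + 1 with hc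
    have hcpos : 0 < c := by positivity
    have hcM : ∀ n, sobModular Set.univ s p (fun x => un n x / c) ≤ 1 := by
      intro n
      have hlt : sobNorm Set.univ s p (un n) < c := by
        have := hC n
        have := le_abs_self C
        linarith
      obtain ⟨b, ⟨hb, hbM⟩, hbc⟩ :=
        exists_lt_of_csInf_lt (sob_set_nonempty s p hp1 _ (hun n).2) hlt
      have h1 := sobModular_scale s p hp1 (fun x => un n x / b) (κ := b / c) (by positivity)
        ((div_le_one hcpos).2 hbc.le)
      have e : (fun x => un n x / c) = fun x => b / c * (un n x / b) := by
        funext x; field_simp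
      rw [e]
      refine h1.trans ((mul_le_mul' (ENNReal.ofReal_le_one.2 ((div_le_one hcpos).2 hbc.le))
        hbM).trans ?_)
      simp
    set v : ℕ → Euc N → ℝ := fun n x => un n x / c with hv
    have hvm : ∀ n, AEStronglyMeasurable (v n) volume := fun n => by
      simp only [hv, div_eq_mul_inv]
      exact (hum n).mul_const _
    have hvK : ∀ n, ∫⁻ x, ENNReal.ofReal (|v n x| ^ q x) ≤ ENNReal.ofReal K :=
      fun n => hKb _ (hvm n) (hcM n)
    obtain ⟨V, φ, hφ, hVm, hVlim0⟩ := ae_subseq hs0 p hpc pplus hp1 hpp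
      (fun n => (hvm n).mk (v n)) (fun n => (hvm n).stronglyMeasurable_mk.measurable)
      (fun n => by rw [← sobModular_congr s p _ _ (hvm n).ae_eq_mk]; exact hcM n)
    have hVlim : ∀ᵐ x, Tendsto (fun k => v (φ k) x) atTop (𝓝 (V x)) := by
      have h1 : ∀ᵐ x, ∀ n, v n x = (hvm n).mk (v n) x := ae_all_iff.2 fun n => (hvm n).ae_eq_mk
      filter_upwards [h1, hVlim0] with x hx hx2
      simpa only [hx] using hx2
    have hqpow : ∀ f : Euc N → ℝ, AEMeasurable f volume →
        AEMeasurable (fun x => ENNReal.ofReal (|f x| ^ q x)) volume := fun f hf => by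
      have h1 : AEMeasurable (fun x => |f x|) volume := hf.norm
      exact (h1.pow hqmeas.aemeasurable).ennreal_ofReal
    have hVK : ∫⁻ x, ENNReal.ofReal (|V x| ^ q x) ≤ ENNReal.ofReal K := by
      calc ∫⁻ x, ENNReal.ofReal (|V x| ^ q x)
          = ∫⁻ x, liminf (fun k => ENNReal.ofReal (|v (φ k) x| ^ q x)) atTop := by
            apply lintegral_congr_ae
            filter_upwards [hVlim] with x hx
            refine (Tendsto.liminf_eq ?_).symm
            exact ENNReal.tendsto_ofReal (hx.abs.rpow_const (Or.inr (by linarith [hqm x])))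
        _ ≤ liminf (fun k => ∫⁻ x, ENNReal.ofReal (|v (φ k) x| ^ q x)) atTop :=
            lintegral_liminf_le' fun k => hqpow _ (hvm _).aemeasurable
        _ ≤ _ := by
            refine le_trans (liminf_le_liminf (v := fun _ => ENNReal.ofReal K)
              (Eventually.of_forall fun n => hvK _)) ?_
            simp
    set K2 : ℝ := 2 ^ qplus * (K + K) with hK2
    have hK2pos : 0 < K2 := by positivity
    have hzK : ∀ k, ∫⁻ x, ENNReal.ofReal (|v (φ k) x - V x| ^ q x) ≤ ENNReal.ofReal K2 := by
      intro k
      calc _ ≤ ∫⁻ x, ENNReal.ofReal (2 ^ qplus) *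
            (ENNReal.ofReal (|v (φ k) x| ^ q x) + ENNReal.ofReal (|V x| ^ q x)) := by
            apply lintegral_mono
            intro x
            simp only
            rw [← ENNReal.ofReal_add (by positivity) (by positivity),
              ← ENNReal.ofReal_mul (by positivity)]
            exact ENNReal.ofReal_le_ofReal (add_rpow_le (by linarith [hqm x]) (hqp x))
        _ = ENNReal.ofReal (2 ^ qplus) * ((∫⁻ x, ENNReal.ofReal (|v (φ k) x| ^ q x)) +
              ∫⁻ x, ENNReal.ofReal (|V x| ^ q x)) := by
            rw [lintegral_const_mul' _ _ ENNReal.ofReal_ne_top,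
              lintegral_add_left' (hqpow _ (hvm _).aemeasurable)]
        _ ≤ ENNReal.ofReal (2 ^ qplus) * (ENNReal.ofReal K + ENNReal.ofReal K) := by
            gcongr
            exact hvK _
        _ = _ := by
            rw [← ENNReal.ofReal_add hK.le hK.le, ← ENNReal.ofReal_mul (by positivity)]
    refine ⟨fun x => V x * c, φ, hφ, ⟨(hVm.mul_const c).aestronglyMeasurable, ?_⟩, ?_⟩
    · refine lt_of_le_of_lt (mod_bound q r hqmeas hrmeas hr1 δ hδ hqr w hwmeas _) ?_
      refine ENNReal.add_lt_top.2 ⟨?_, hw.2⟩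
      have h2 := hfinscale V c⁻¹ (inv_pos.2 hcpos) (lt_of_le_of_lt hVK ENNReal.ofReal_lt_top)
      simp only [div_inv_eq_mul] at h2
      exact lt_of_le_of_lt h2 (ENNReal.mul_lt_top ENNReal.ofReal_lt_top
          (lt_of_le_of_lt hVK ENNReal.ofReal_lt_top))
    · have hmod : ∀ l : ℝ, 0 < l → Tendsto (fun k => varModular μ r
          (fun x => (v (φ k) x - V x) / l)) atTop (𝓝 0) := by
        intro l hl
        apply mod_tendsto q r hqmeas hrmeas hr1 rplus hrp δ hδ hqr w hwmeas hw.2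
          (fun k x => (v (φ k) x - V x) / l)
          (fun k => ((hvm _).aemeasurable.sub hVm.aemeasurable).div_const l)
          ((1 + l⁻¹) ^ qplus * K2) (by positivity)
        · intro k
          refine (hfinscale (fun x => v (φ k) x - V x) l hl
            (lt_of_le_of_lt (hzK k) ENNReal.ofReal_lt_top)).trans ?_
          rw [ENNReal.ofReal_mul (by positivity)]
          gcongr
          exact hzK k
        · filter_upwards [hVlim] with x hx
          have := (hx.sub_const (V x)).div_const l
          simpa using this
      rw [Metric.tendsto_atTop]
      intro ε hε
      have h1 := hmod (ε / 2 / c) (by positivity)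
      obtain ⟨n0, hn0⟩ := eventually_atTop.1 ((ENNReal.tendsto_nhds_zero.1 h1) 1 one_pos)
      refine ⟨n0, fun n hn => ?_⟩
      rw [Real.dist_eq, sub_zero, abs_of_nonneg (luxNorm_nonneg _ _ _)]
      refine lt_of_le_of_lt (luxNorm_le _ _ _ (c := ε / 2) (by positivity) ?_) (by linarith)
      refine le_trans (le_of_eq ?_) (hn0 n hn)
      congr 1
      funext x
      simp only [hv]
      field_simp
end
end
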